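/- Let n ≥ 2 and let T : ℝ^n → ℝ^m be a linear map. Let S* = {μ_T(P) : P a proper n-system} and let S₁ = {μ_T(S) : S a self-similar integral n-system}. Then S₁ is a dense subset of S*, and S* is a connected subset of ℝ^m. -/

import Mathlib

open Filter Set Pointwise Topology

noncomputable section

/-- Points of `ℝ^n`. -/
abbrev RVec (n : ℕ) := Fin n → ℝ

/-- The vector of `ℝ^n` with a `1` in position `j` (0-based) and `0` elsewhere;
`eVec n 0` is the first canonical basis vector `e_1`. -/
def eVec (n : ℕ) (j : ℕ) : RVec n := fun i => if (i : ℕ) = j then 1 else 0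

/-- `P` is an `n`-system on the subinterval `I` of `[0,∞)`:
`I` is an order-connected subset of `[0,∞)` with nonempty interior, and conditions
(S1), (S2), (S3) hold at every `q ∈ I`. -/
def IsNSystem (n : ℕ) (I : Set ℝ) (P : ℝ → RVec n) : Prop :=
  I ⊆ Set.Ici (0 : ℝ) ∧ I.OrdConnected ∧ (interior I).Nonempty ∧
  ∀ q ∈ I,
    ((∀ i, 0 ≤ P q i) ∧ Monotone (P q) ∧ (∑ i, P q i) = q) ∧
    ∃ ε > (0 : ℝ), ∃ k ℓ : Fin n,
      (∀ t ∈ I ∩ Set.Icc (q - ε) q, P t = P q + (t - q) • eVec n ℓ) ∧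
      (∀ t ∈ I ∩ Set.Icc q (q + ε), P t = P q + (t - q) • eVec n k) ∧
      (q ∈ interior I → ℓ < k → ∀ i : Fin n, ℓ ≤ i → i ≤ k → P q i = P q ℓ)

/-- `P` is a proper `n`-system on `I`: it is an `n`-system whose first component is
unbounded (by the monotonicity (S1) of the components, this is equivalent to all
components simultaneously exceeding any given bound). -/
def IsProperSys (n : ℕ) (I : Set ℝ) (P : ℝ → RVec n) : Prop :=
  IsNSystem n I P ∧ ∀ M : ℝ, ∃ q ∈ I, ∀ i, M < P q i

/-- The set `F(P)` of limits of `q_i⁻¹ • P(q_i)` along strictly increasing unbounded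
sequences `(q_i)` in `I`. -/
def FSet (n : ℕ) (I : Set ℝ) (P : ℝ → RVec n) : Set (RVec n) :=
  {x | ∃ q : ℕ → ℝ, (∀ i, q i ∈ I) ∧ StrictMono q ∧
    Tendsto q atTop atTop ∧ Tendsto (fun i => (q i)⁻¹ • P (q i)) atTop (𝓝 x)}

/-- The set `F(P, e₁)`: as `F(P)`, but with the extra requirement that the right
derivative of `P` at each `q_i` is the first basis vector `e_1`. -/
def FSetE1 (n : ℕ) (I : Set ℝ) (P : ℝ → RVec n) : Set (RVec n) :=
  {x | ∃ q : ℕ → ℝ, (∀ i, q i ∈ I) ∧ StrictMono q ∧ Tendsto q atTop atTop ∧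
    (∀ i, ∃ ε > (0 : ℝ), ∀ t ∈ I ∩ Set.Icc (q i) (q i + ε),
      P t = P (q i) + (t - q i) • eVec n 0) ∧
    Tendsto (fun i => (q i)⁻¹ • P (q i)) atTop (𝓝 x)}

/-- `q` is a switch number of the `n`-system `P` on `I`: a point of `I` on the boundary
of `I`, or an interior point where the local slopes `e_k` (right) and `e_ℓ` (left)
from (S2) satisfy `k < ℓ`. -/
def IsSwitchNumber (n : ℕ) (I : Set ℝ) (P : ℝ → RVec n) (q : ℝ) : Prop :=
  q ∈ I ∧ (q ∈ frontier I ∨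
    (q ∈ interior I ∧ ∃ ε > (0 : ℝ), ∃ k ℓ : Fin n, k < ℓ ∧
      (∀ t ∈ I ∩ Set.Icc (q - ε) q, P t = P q + (t - q) • eVec n ℓ) ∧
      (∀ t ∈ I ∩ Set.Icc q (q + ε), P t = P q + (t - q) • eVec n k)))

/-- `q` is a division number of the `n`-system `P` on `I`: a point of `I` on the boundary
of `I`, or an interior point where `P` is not differentiable, i.e. where the left and
right slopes from (S2) differ. -/
def IsDivisionNumber (n : ℕ) (I : Set ℝ) (P : ℝ → RVec n) (q : ℝ) : Prop :=
  q ∈ I ∧ (q ∈ frontier I ∨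
    (q ∈ interior I ∧ ∃ ε > (0 : ℝ), ∃ k ℓ : Fin n, k ≠ ℓ ∧
      (∀ t ∈ I ∩ Set.Icc (q - ε) q, P t = P q + (t - q) • eVec n ℓ) ∧
      (∀ t ∈ I ∩ Set.Icc q (q + ε), P t = P q + (t - q) • eVec n k)))

/-- A non-degenerate `n`-system: an `n`-system whose domain is a closed subinterval
of `(0,∞)` and whose switch points all have `n` distinct positive coordinates. -/
def IsNonDegenerate (n : ℕ) (I : Set ℝ) (P : ℝ → RVec n) : Prop :=
  IsNSystem n I P ∧ IsClosed I ∧ I ⊆ Set.Ioi (0 : ℝ) ∧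
  ∀ q, IsSwitchNumber n I P q → (∀ i, 0 < P q i) ∧ StrictMono (P q)

/-- A rigid `n`-system of mesh `δ`: a non-degenerate `n`-system whose switch points
belong to `δℤ^n`. -/
def IsRigid (n : ℕ) (δ : ℝ) (I : Set ℝ) (P : ℝ → RVec n) : Prop :=
  IsNonDegenerate n I P ∧
  ∀ q, IsSwitchNumber n I P q → ∀ i, ∃ m : ℤ, P q i = δ * m

/-- A self-similar system: the domain is unbounded and there is `ρ > 1` with
`P(ρq) = ρ • P(q)` for all `q` in the domain. -/
def IsSelfSimilar (n : ℕ) (I : Set ℝ) (P : ℝ → RVec n) : Prop :=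
  ¬ BddAbove I ∧ ∃ ρ : ℝ, 1 < ρ ∧ ∀ q ∈ I, ρ * q ∈ I ∧ P (ρ * q) = ρ • P q

/-- The cube `[-ε, ε]^n`. -/
def cubeNbhd (n : ℕ) (ε : ℝ) : Set (RVec n) := {y | ∀ i, |y i| ≤ ε}

/-- The distance `dist(E, F)`: the infimum of all `ε > 0` such that
`E ⊆ F + [-ε,ε]^n` and `F ⊆ E + [-ε,ε]^n`. -/
def cubeDist (n : ℕ) (E F : Set (RVec n)) : ℝ :=
  sInf {ε : ℝ | 0 < ε ∧ E ⊆ F + cubeNbhd n ε ∧ F ⊆ E + cubeNbhd n ε}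

/-- `μ_T(P)`: the point of `ℝ^m` whose `j`-th coordinate is
`liminf_{q → ∞, q ∈ I} T_j(P(q))/q`. -/
def muT (n m : ℕ) (T : RVec n → RVec m) (I : Set ℝ) (P : ℝ → RVec n) : RVec m :=
  fun j => Filter.liminf (fun q => T (P q) j / q) (atTop ⊓ 𝓟 I)

/-- `liminf` of a sequence of subsets of `ℝ^n`: the set of limits of convergent
sequences `(x_i)` with `x_i ∈ F i` for every `i`. -/
def setLiminf (n : ℕ) (F : ℕ → Set (RVec n)) : Set (RVec n) :=
  {x | ∃ y : ℕ → RVec n, (∀ i, y i ∈ F i) ∧ Tendsto y atTop (𝓝 x)}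

/-- `limsup` of a sequence of subsets of `ℝ^n`: the set of accumulation points of
sequences `(x_i)` with `x_i ∈ F i` for every `i`, i.e. limits of convergent
subsequences. -/
def setLimsup (n : ℕ) (F : ℕ → Set (RVec n)) : Set (RVec n) :=
  {x | ∃ (y : ℕ → RVec n) (φ : ℕ → ℕ), (∀ i, y i ∈ F i) ∧ StrictMono φ ∧
    Tendsto (y ∘ φ) atTop (𝓝 x)}

/-! ### Sorting the coordinates of a point -/

/-- The point with the same coordinates as `v`, in nondecreasing order. -/
def srt {n : ℕ} (v : RVec n) : RVec n := v ∘ Tuple.sort v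

theorem add_smul_eVec_apply {n : ℕ} (v : RVec n) (r : ℝ) (k j : Fin n) :
    (v + r • eVec n k) j = v j + if j = k then r else 0 := by
  simp [eVec, Fin.ext_iff]

theorem sum_add_smul_eVec {n : ℕ} (v : RVec n) (r : ℝ) (k : Fin n) :
    ∑ j, (v + r • eVec n k) j = (∑ j, v j) + r := by
  simp only [add_smul_eVec_apply, Finset.sum_add_distrib]
  simp

theorem srt_monotone {n : ℕ} (v : RVec n) : Monotone (srt v) := Tuple.monotone_sort v

theorem sum_srt {n : ℕ} (v : RVec n) : ∑ j, srt v j = ∑ j, v j :=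
  Equiv.sum_comp (Tuple.sort v) v

theorem exists_srt_eq {n : ℕ} (v : RVec n) (i : Fin n) : ∃ j, srt v i = v j :=
  ⟨Tuple.sort v i, rfl⟩

theorem exists_eq_srt {n : ℕ} (v : RVec n) (j : Fin n) : ∃ i, srt v i = v j :=
  ⟨(Tuple.sort v).symm j, by simp [srt]⟩

theorem srt_eq_comp {n : ℕ} (v : RVec n) (σ : Equiv.Perm (Fin n)) (h : Monotone (v ∘ σ)) :
    srt v = v ∘ σ :=
  (Tuple.comp_sort_eq_comp_iff_monotone.mpr h).symm

theorem srt_of_monotone {n : ℕ} {v : RVec n} (h : Monotone v) : srt v = v :=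
  srt_eq_comp v 1 h

theorem srt_smul {n : ℕ} (v : RVec n) {r : ℝ} (hr : 0 ≤ r) : srt (r • v) = r • srt v :=
  srt_eq_comp (r • v) (Tuple.sort v) fun _ _ hij =>
    mul_le_mul_of_nonneg_left (srt_monotone v hij) hr

theorem srt_strictMono {n : ℕ} {v : RVec n} (h : Function.Injective v) : StrictMono (srt v) :=
  (srt_monotone v).strictMono_of_injective (h.comp (Tuple.sort v).injective)

theorem srt_le_srt_add {n : ℕ} {v w : RVec n} {d : ℝ} (h : ∀ j, v j ≤ w j + d) (k : Fin n) :
    srt v k ≤ srt w k + d := by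
  have hcard : ∀ (u : RVec n) (a : ℝ),
      (Finset.univ.filter fun i => srt u i ≤ a).card =
        (Finset.univ.filter fun i => u i ≤ a).card := by
    intro u a
    refine Finset.card_bij (fun i _ => Tuple.sort u i) ?_ ?_ ?_
    · intro i hi
      exact Finset.mem_filter.2 ⟨Finset.mem_univ _, (Finset.mem_filter.1 hi).2⟩
    · intro i _ j _ hij
      exact (Tuple.sort u).injective hij
    · intro j hj
      refine ⟨(Tuple.sort u).symm j, Finset.mem_filter.2 ⟨Finset.mem_univ _, ?_⟩, by simp⟩
      simpa [srt] using (Finset.mem_filter.1 hj).2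
  rw [← Tuple.lt_card_le_iff_apply_le_of_monotone (srt_monotone v), hcard]
  have h1 := (Tuple.lt_card_le_iff_apply_le_of_monotone (j := k) (a := srt w k)
    (srt_monotone w)).2 le_rfl
  rw [hcard] at h1
  refine lt_of_lt_of_le h1 (Finset.card_le_card ?_)
  intro i hi
  simp only [Finset.mem_filter, Finset.mem_univ, true_and] at hi ⊢
  linarith [h i]

theorem abs_srt_sub_le {n : ℕ} {v w : RVec n} {d : ℝ} (h : ∀ j, |v j - w j| ≤ d) (k : Fin n) :
    |srt v k - srt w k| ≤ d := by
  rw [abs_sub_le_iff]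
  constructor
  · linarith [srt_le_srt_add (v := v) (w := w) (d := d)
      (fun j => by linarith [(abs_sub_le_iff.1 (h j)).1]) k]
  · linarith [srt_le_srt_add (v := w) (w := v) (d := d)
      (fun j => by linarith [(abs_sub_le_iff.1 (h j)).2]) k]

theorem srt_add_smul_eVec {n : ℕ} {v : RVec n} {p k : Fin n} {r : ℝ} (hk : srt v k = v p)
    (hm : Monotone (srt v + r • eVec n k)) :
    srt (v + r • eVec n p) = srt v + r • eVec n k := by
  set σ := Tuple.sort v with hσ
  set τ : Equiv.Perm (Fin n) := (Equiv.swap k (σ.symm p)).trans σ with hτ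
  have hτk : τ k = p := by simp [hτ]
  have hv : ∀ i, v (τ i) = srt v i := by
    intro i
    simp only [hτ, Equiv.trans_apply]
    by_cases h1 : i = k
    · subst h1; simp [hk]
    · by_cases h2 : i = σ.symm p
      · subst h2
        rw [Equiv.swap_apply_right]
        have : srt v (σ.symm p) = v p := by simp [srt, hσ]
        rw [this, ← hk]; rfl
      · rw [Equiv.swap_apply_of_ne_of_ne h1 h2]; rfl
  have heq : (v + r • eVec n p) ∘ τ = srt v + r • eVec n k := by
    funext i
    simp only [Function.comp]
    rw [add_smul_eVec_apply, add_smul_eVec_apply, hv]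
    have : τ i = p ↔ i = k := by rw [← hτk]; exact τ.injective.eq_iff
    simp [this]
  rw [← heq]
  exact srt_eq_comp _ _ (heq ▸ hm)

/-- Raising one coordinate slightly raises the last of the equal coordinates after sorting. -/
theorem exists_srt_raise {n : ℕ} (v : RVec n) (p : Fin n) :
    ∃ k, srt v k = v p ∧ (∀ i, srt v i = v p → i ≤ k) ∧
      ∃ ε > (0 : ℝ), ∀ r, 0 ≤ r → r ≤ ε →
        srt (v + r • eVec n p) = srt v + r • eVec n k := by
  have hne : (Finset.univ.filter fun i => srt v i = v p).Nonempty := by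
    obtain ⟨i, hi⟩ := exists_eq_srt v p
    exact ⟨i, by simp [hi]⟩
  obtain ⟨k, hk, hmax⟩ := Finset.exists_max_image _ id hne
  simp only [Finset.mem_filter, Finset.mem_univ, true_and, id] at hk hmax
  have hev : ∀ᶠ e in 𝓝[>] (0 : ℝ), ∀ j, v p < srt v j → v p + e < srt v j := by
    rw [Filter.eventually_all]
    intro j
    by_cases hj : v p < srt v j
    · have : ∀ᶠ e in 𝓝 (0 : ℝ), e < srt v j - v p := eventually_lt_nhds (by linarith)
      filter_upwards [nhdsWithin_le_nhds this] with e he _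
      linarith
    · exact Filter.Eventually.of_forall fun e h => absurd h hj
  obtain ⟨ε, hε, hpos⟩ := (hev.and self_mem_nhdsWithin).exists
  refine ⟨k, hk, hmax, ε, hpos, fun r hr hrε => srt_add_smul_eVec hk fun i j hij => ?_⟩
  rw [add_smul_eVec_apply, add_smul_eVec_apply]
  have hmono := srt_monotone v hij
  rcases eq_or_ne i j with rfl | hne'
  · exact le_rfl
  · have hlt : i < j := lt_of_le_of_ne hij hne'
    by_cases hi : i = k
    · subst hi
      have h1 : srt v j ≠ v p := fun h => absurd (hmax j h) (not_le.2 hlt)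
      have h2 : v p < srt v j := lt_of_le_of_ne (hk ▸ hmono) (Ne.symm h1)
      have := hε j h2
      rw [if_pos rfl, if_neg (Ne.symm hne')]
      linarith
    · rw [if_neg hi]
      split_ifs <;> linarith

/-- Lowering one coordinate slightly lowers the first of the equal coordinates after sorting. -/
theorem exists_srt_lower {n : ℕ} (v : RVec n) (p : Fin n) :
    ∃ k, srt v k = v p ∧ (∀ i, srt v i = v p → k ≤ i) ∧
      ∃ ε > (0 : ℝ), ∀ r, r ≤ 0 → -ε ≤ r →
        srt (v + r • eVec n p) = srt v + r • eVec n k := by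
  have hne : (Finset.univ.filter fun i => srt v i = v p).Nonempty := by
    obtain ⟨i, hi⟩ := exists_eq_srt v p
    exact ⟨i, by simp [hi]⟩
  obtain ⟨k, hk, hmin⟩ := Finset.exists_min_image _ id hne
  simp only [Finset.mem_filter, Finset.mem_univ, true_and, id] at hk hmin
  have hev : ∀ᶠ e in 𝓝[>] (0 : ℝ), ∀ j, srt v j < v p → srt v j < v p - e := by
    rw [Filter.eventually_all]
    intro j
    by_cases hj : srt v j < v p
    · have : ∀ᶠ e in 𝓝 (0 : ℝ), e < v p - srt v j := eventually_lt_nhds (by linarith)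
      filter_upwards [nhdsWithin_le_nhds this] with e he _
      linarith
    · exact Filter.Eventually.of_forall fun e h => absurd h hj
  obtain ⟨ε, hε, hpos⟩ := (hev.and self_mem_nhdsWithin).exists
  refine ⟨k, hk, hmin, ε, hpos, fun r hr hrε => srt_add_smul_eVec hk fun i j hij => ?_⟩
  rw [add_smul_eVec_apply, add_smul_eVec_apply]
  have hmono := srt_monotone v hij
  rcases eq_or_ne i j with rfl | hne'
  · exact le_rfl
  · have hlt : i < j := lt_of_le_of_ne hij hne'
    by_cases hj : j = k
    · subst hj
      have h1 : srt v i ≠ v p := fun h => absurd (hmin i h) (not_le.2 hlt)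
      have h2 : srt v i < v p := lt_of_le_of_ne (hk ▸ hmono) h1
      have := hε i h2
      rw [if_pos rfl, if_neg hne']
      linarith
    · rw [if_neg hj]
      split_ifs <;> linarith

/-! ### Systems built from sequences of moves -/

/-- A sequence of states `s i`, each obtained from the previous one by raising the single
coordinate `p i`, such that the next coordinate to be raised never lies above the one which
was just raised, and such that all coordinates tend to infinity. -/
structure IsMoveSeq (n : ℕ) (s : ℕ → RVec n) (p : ℕ → Fin n) : Prop where
  pos : ∀ i j, 0 < s i j
  step : ∀ i, s i (p i) < s (i + 1) (p i)
  fix : ∀ i j, j ≠ p i → s (i + 1) j = s i j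
  legal : ∀ i, s (i + 1) (p (i + 1)) ≤ s (i + 1) (p i)
  unbounded : ∀ M : ℝ, ∃ i, ∀ j, M < s i j

/-- The sum of the coordinates of the `i`-th state. -/
def stateTime {n : ℕ} (s : ℕ → RVec n) (i : ℕ) : ℝ := ∑ j, s i j

open Classical in
/-- The unsorted path through the states `s i`, parametrized by the sum of coordinates. -/
def rawPath {n : ℕ} (s : ℕ → RVec n) (p : ℕ → Fin n) (q : ℝ) : RVec n :=
  if h : ∃ i, q < stateTime s (i + 1) then
    s (Nat.find h) + (q - stateTime s (Nat.find h)) • eVec n (p (Nat.find h))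
  else 0

/-- The sorted path through the states `s i`. -/
def sysPath {n : ℕ} (s : ℕ → RVec n) (p : ℕ → Fin n) (q : ℝ) : RVec n := srt (rawPath s p q)

theorem eVec_ne_zero_inj {n : ℕ} {v : RVec n} {r : ℝ} (hr : r ≠ 0) {k l : Fin n}
    (h : v + r • eVec n k = v + r • eVec n l) : k = l := by
  have h1 := congrFun h k
  rw [add_smul_eVec_apply, add_smul_eVec_apply] at h1
  by_contra hne
  rw [if_pos rfl, if_neg hne] at h1
  apply hr
  linarith

namespace IsMoveSeq

variable {n : ℕ} {s : ℕ → RVec n} {p : ℕ → Fin n}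

theorem state_succ (h : IsMoveSeq n s p) (i : ℕ) :
    s (i + 1) = s i + (stateTime s (i + 1) - stateTime s i) • eVec n (p i) := by
  have h1 : s (i + 1) = s i + (s (i + 1) (p i) - s i (p i)) • eVec n (p i) := by
    funext j
    rw [add_smul_eVec_apply]
    split_ifs with hj
    · subst hj; ring
    · rw [h.fix i j hj, add_zero]
  have h2 : stateTime s (i + 1) = stateTime s i + (s (i + 1) (p i) - s i (p i)) := by
    unfold stateTime
    conv_lhs => rw [h1]
    rw [sum_add_smul_eVec]
  rw [h2, add_sub_cancel_left]
  exact h1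

theorem stateTime_lt (h : IsMoveSeq n s p) (i : ℕ) : stateTime s i < stateTime s (i + 1) := by
  refine Finset.sum_lt_sum (fun j _ => ?_) ⟨p i, Finset.mem_univ _, h.step i⟩
  by_cases hj : j = p i
  · subst hj; exact (h.step i).le
  · exact (h.fix i j hj).ge

theorem stateTime_strictMono (h : IsMoveSeq n s p) : StrictMono (stateTime s) :=
  strictMono_nat_of_lt_succ h.stateTime_lt

theorem le_stateTime (h : IsMoveSeq n s p) (i : ℕ) (j : Fin n) : s i j ≤ stateTime s i :=
  Finset.single_le_sum (f := s i) (fun j _ => (h.pos i j).le) (Finset.mem_univ j)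

theorem stateTime_pos (h : IsMoveSeq n s p) (i : ℕ) : 0 < stateTime s i :=
  (h.pos i (p 0)).trans_le (h.le_stateTime i (p 0))

theorem exists_lt_stateTime (h : IsMoveSeq n s p) (q : ℝ) : ∃ i, q < stateTime s i := by
  obtain ⟨i, hi⟩ := h.unbounded q
  exact ⟨i, (hi (p 0)).trans_le (h.le_stateTime i (p 0))⟩

theorem exists_right (h : IsMoveSeq n s p) {q : ℝ} (hq : stateTime s 0 ≤ q) :
    ∃ i, stateTime s i ≤ q ∧ q < stateTime s (i + 1) := by
  classical
  have hex := h.exists_lt_stateTime q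
  have hspec := Nat.find_spec hex
  obtain ⟨i, hi⟩ : ∃ i, Nat.find hex = i + 1 := by
    refine Nat.exists_eq_succ_of_ne_zero fun h0 => ?_
    rw [h0] at hspec
    linarith
  refine ⟨i, not_lt.1 (Nat.find_min hex (by omega)), hi ▸ hspec⟩

theorem exists_left (h : IsMoveSeq n s p) {q : ℝ} (hq : stateTime s 0 < q) :
    ∃ i, stateTime s i < q ∧ q ≤ stateTime s (i + 1) := by
  obtain ⟨i, hi, hi'⟩ := h.exists_right hq.le
  rcases hi.lt_or_eq with hlt | heq
  · exact ⟨i, hlt, hi'.le⟩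
  · cases i with
    | zero => exact absurd heq hq.ne
    | succ i => exact ⟨i, heq ▸ h.stateTime_lt i, heq.ge⟩

theorem rawPath_eq_of_lt (h : IsMoveSeq n s p) {q : ℝ} {i : ℕ} (h1 : stateTime s i ≤ q)
    (h2 : q < stateTime s (i + 1)) :
    rawPath s p q = s i + (q - stateTime s i) • eVec n (p i) := by
  classical
  have hex : ∃ i, q < stateTime s (i + 1) := ⟨i, h2⟩
  have hfind : Nat.find hex = i := by
    rw [Nat.find_eq_iff]
    refine ⟨h2, fun k hk => not_lt.2 (le_trans ?_ h1)⟩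
    exact h.stateTime_strictMono.monotone hk
  unfold rawPath
  rw [dif_pos hex]
  convert rfl using 3
  all_goals first | rfl | (rw [← hfind])

theorem rawPath_state (h : IsMoveSeq n s p) (i : ℕ) : rawPath s p (stateTime s i) = s i := by
  rw [h.rawPath_eq_of_lt le_rfl (h.stateTime_lt i)]
  simp

theorem rawPath_eq (h : IsMoveSeq n s p) {q : ℝ} {i : ℕ} (h1 : stateTime s i ≤ q)
    (h2 : q ≤ stateTime s (i + 1)) :
    rawPath s p q = s i + (q - stateTime s i) • eVec n (p i) := by
  rcases h2.lt_or_eq with hlt | heq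
  · exact h.rawPath_eq_of_lt h1 hlt
  · rw [heq, h.rawPath_state]
    exact h.state_succ i

theorem sysPath_state (h : IsMoveSeq n s p) (i : ℕ) :
    sysPath s p (stateTime s i) = srt (s i) := by
  rw [sysPath, h.rawPath_state]

theorem rawPath_add (h : IsMoveSeq n s p) {q t : ℝ} {i : ℕ} (h1 : stateTime s i ≤ q)
    (h2 : q ≤ stateTime s (i + 1)) (h3 : stateTime s i ≤ t) (h4 : t ≤ stateTime s (i + 1)) :
    rawPath s p t = rawPath s p q + (t - q) • eVec n (p i) := by
  rw [h.rawPath_eq h1 h2, h.rawPath_eq h3 h4, add_assoc, ← add_smul]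
  congr 2
  ring

theorem sum_rawPath (h : IsMoveSeq n s p) {q : ℝ} (hq : stateTime s 0 ≤ q) :
    ∑ j, rawPath s p q j = q := by
  obtain ⟨i, h1, h2⟩ := h.exists_right hq
  rw [h.rawPath_eq h1 h2.le, sum_add_smul_eVec]
  change stateTime s i + _ = q
  ring

theorem rawPath_pos (h : IsMoveSeq n s p) {q : ℝ} (hq : stateTime s 0 ≤ q) (j : Fin n) :
    0 < rawPath s p q j := by
  obtain ⟨i, h1, h2⟩ := h.exists_right hq
  rw [h.rawPath_eq h1 h2.le, add_smul_eVec_apply]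
  have := h.pos i j
  split_ifs <;> linarith

theorem sysPath_right (h : IsMoveSeq n s p) {q : ℝ} {i : ℕ} (h1 : stateTime s i ≤ q)
    (h2 : q < stateTime s (i + 1)) :
    ∃ k, sysPath s p q k = rawPath s p q (p i) ∧
      (∀ l, sysPath s p q l = rawPath s p q (p i) → l ≤ k) ∧
      ∃ ε > (0 : ℝ), ∀ t, q ≤ t → t ≤ q + ε →
        sysPath s p t = sysPath s p q + (t - q) • eVec n k := by
  obtain ⟨k, hk, hmax, ε, hε, hr⟩ := exists_srt_raise (rawPath s p q) (p i)
  refine ⟨k, hk, hmax, min ε (stateTime s (i + 1) - q), lt_min hε (by linarith),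
    fun t ht1 ht2 => ?_⟩
  have ht3 : t ≤ q + ε := ht2.trans (by linarith [min_le_left ε (stateTime s (i + 1) - q)])
  have ht4 : t ≤ stateTime s (i + 1) :=
    ht2.trans (by linarith [min_le_right ε (stateTime s (i + 1) - q)])
  unfold sysPath
  rw [h.rawPath_add h1 h2.le (h1.trans ht1) ht4]
  exact hr _ (by linarith) (by linarith)

theorem sysPath_left (h : IsMoveSeq n s p) {q : ℝ} {i : ℕ} (h1 : stateTime s i < q)
    (h2 : q ≤ stateTime s (i + 1)) :
    ∃ k, sysPath s p q k = rawPath s p q (p i) ∧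
      (∀ l, sysPath s p q l = rawPath s p q (p i) → k ≤ l) ∧
      ∃ ε > (0 : ℝ), ∀ t, q - ε ≤ t → t ≤ q →
        sysPath s p t = sysPath s p q + (t - q) • eVec n k := by
  obtain ⟨k, hk, hmax, ε, hε, hr⟩ := exists_srt_lower (rawPath s p q) (p i)
  refine ⟨k, hk, hmax, min ε (q - stateTime s i), lt_min hε (by linarith),
    fun t ht1 ht2 => ?_⟩
  have ht3 : q - ε ≤ t := le_trans (by linarith [min_le_left ε (q - stateTime s i)]) ht1
  have ht4 : stateTime s i ≤ t :=
    le_trans (by linarith [min_le_right ε (q - stateTime s i)]) ht1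
  unfold sysPath
  rw [h.rawPath_add h1.le h2 ht4 (ht2.trans h2)]
  exact hr _ (by linarith) (by linarith)

theorem rawPath_legal (h : IsMoveSeq n s p) {q : ℝ} {i i' : ℕ} (h1 : stateTime s i < q)
    (h2 : q ≤ stateTime s (i + 1)) (h3 : stateTime s i' ≤ q) (h4 : q < stateTime s (i' + 1)) :
    rawPath s p q (p i') ≤ rawPath s p q (p i) := by
  have ha : i < i' + 1 := h.stateTime_strictMono.lt_iff_lt.1 (h1.trans h4)
  have hb : i' ≤ i + 1 := h.stateTime_strictMono.le_iff_le.1 (h3.trans h2)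
  rcases (show i' = i ∨ i' = i + 1 by omega) with rfl | rfl
  · exact le_rfl
  · have hq : q = stateTime s (i + 1) := le_antisymm h2 h3
    rw [hq, h.rawPath_state]
    exact h.legal i

theorem isNSystem (h : IsMoveSeq n s p) :
    IsNSystem n (Ici (stateTime s 0)) (sysPath s p) := by
  have h0 := h.stateTime_pos 0
  refine ⟨Ici_subset_Ici.2 h0.le, ordConnected_Ici, ?_, fun q hq => ⟨⟨?_, ?_, ?_⟩, ?_⟩⟩
  · rw [interior_Ici]; exact nonempty_Ioi
  · intro i
    obtain ⟨j, hj⟩ := exists_srt_eq (rawPath s p q) i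
    rw [sysPath, hj]
    exact (h.rawPath_pos hq j).le
  · exact srt_monotone _
  · rw [sysPath, sum_srt, h.sum_rawPath hq]
  · obtain ⟨i', h3, h4⟩ := h.exists_right hq
    obtain ⟨k, hk, hkmax, ε, hε, hr⟩ := h.sysPath_right h3 h4
    rcases (mem_Ici.1 hq).lt_or_eq with hlt | heq
    · obtain ⟨i, h1, h2⟩ := h.exists_left hlt
      obtain ⟨l, hl, hlmin, ε', hε', hr'⟩ := h.sysPath_left h1 h2
      refine ⟨min ε ε', lt_min hε hε', k, l, ?_, ?_, ?_⟩
      · rintro t ⟨-, ht1, ht2⟩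
        exact hr' t (by linarith [min_le_right ε ε']) ht2
      · rintro t ⟨-, ht1, ht2⟩
        exact hr t ht1 (by linarith [min_le_left ε ε'])
      · intro _ hlk i'' hi1 hi2
        have hleg := h.rawPath_legal h1 h2 h3 h4
        have hm : Monotone (sysPath s p q) := srt_monotone _
        have := hm hi1
        have := hm hi2
        linarith
    · refine ⟨ε, hε, k, k, ?_, ?_, ?_⟩
      · rintro t ⟨ht0, ht1, ht2⟩
        have : t = q := le_antisymm ht2 (heq ▸ ht0)
        simp [this]
      · rintro t ⟨-, ht1, ht2⟩
        exact hr t ht1 ht2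
      · intro _ hkk
        exact absurd hkk (lt_irrefl _)

theorem isProperSys (h : IsMoveSeq n s p) :
    IsProperSys n (Ici (stateTime s 0)) (sysPath s p) := by
  refine ⟨h.isNSystem, fun M => ?_⟩
  obtain ⟨i, hi⟩ := h.unbounded M
  refine ⟨stateTime s i, h.stateTime_strictMono.monotone (Nat.zero_le i), fun j => ?_⟩
  rw [h.sysPath_state]
  obtain ⟨k, hk⟩ := exists_srt_eq (s i) j
  rw [hk]
  exact hi k

theorem isSwitchNumber (h : IsMoveSeq n s p) {q : ℝ}
    (hq : IsSwitchNumber n (Ici (stateTime s 0)) (sysPath s p) q) :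
    ∃ i, q = stateTime s i := by
  obtain ⟨hqI, hfr | ⟨hint, ε, hε, k, l, hkl, hleft, hright⟩⟩ := hq
  · rw [frontier_Ici] at hfr
    exact ⟨0, hfr⟩
  · rw [interior_Ici] at hint
    by_contra hno
    push Not at hno
    obtain ⟨i, h1, h2⟩ := h.exists_right hqI
    have h1' : stateTime s i < q := lt_of_le_of_ne h1 (hno i).symm
    obtain ⟨k', hk', hkmax, ε1, hε1, hr⟩ := h.sysPath_right h1 h2
    obtain ⟨l', hl', hlmin, ε2, hε2, hr'⟩ := h.sysPath_left h1' h2.le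
    have hkk : k = k' := by
      have hpos : 0 < min ε ε1 := lt_min hε hε1
      have ha := hright (q + min ε ε1) ⟨by
        have : stateTime s 0 ≤ q := hqI
        exact mem_Ici.2 (by linarith), by linarith, by linarith [min_le_left ε ε1]⟩
      rw [hr (q + min ε ε1) (by linarith) (by linarith [min_le_right ε ε1])] at ha
      exact (eVec_ne_zero_inj (by simpa using hpos.ne') ha).symm
    have hll : l = l' := by
      have hlt : stateTime s 0 < q := hint
      have hpos : 0 < min (min ε ε2) (q - stateTime s 0) :=
        lt_min (lt_min hε hε2) (by linarith)
      set d := min (min ε ε2) (q - stateTime s 0) with hd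
      have hd1 : d ≤ ε := (min_le_left _ _).trans (min_le_left _ _)
      have hd2 : d ≤ ε2 := (min_le_left _ _).trans (min_le_right _ _)
      have hd3 : d ≤ q - stateTime s 0 := min_le_right _ _
      have ha := hleft (q - d) ⟨mem_Ici.2 (by linarith), by linarith, by linarith⟩
      rw [hr' (q - d) (by linarith) (by linarith)] at ha
      exact (eVec_ne_zero_inj (by simpa using hpos.ne') ha).symm
    subst hkk hll
    exact absurd (hkmax l hl') (not_le.2 hkl)

theorem isRigid (h : IsMoveSeq n s p) (hinj : ∀ i, Function.Injective (s i))
    (hint : ∀ i j, ∃ z : ℤ, s i j = z) :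
    IsRigid n 1 (Ici (stateTime s 0)) (sysPath s p) := by
  have h0 := h.stateTime_pos 0
  refine ⟨⟨h.isNSystem, isClosed_Ici, Ici_subset_Ioi.2 h0, fun q hq => ?_⟩, fun q hq j => ?_⟩
  · obtain ⟨i, rfl⟩ := h.isSwitchNumber hq
    rw [h.sysPath_state]
    refine ⟨fun j => ?_, srt_strictMono (hinj i)⟩
    obtain ⟨k, hk⟩ := exists_srt_eq (s i) j
    rw [hk]
    exact h.pos i k
  · obtain ⟨i, rfl⟩ := h.isSwitchNumber hq
    rw [h.sysPath_state]
    obtain ⟨k, hk⟩ := exists_srt_eq (s i) j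
    obtain ⟨z, hz⟩ := hint i k
    exact ⟨z, by rw [hk, hz, one_mul]⟩

theorem stateTime_add (N : ℕ) (ρ : ℝ) (hs : ∀ i, s (i + N) = ρ • s i) (i : ℕ) :
    stateTime s (i + N) = ρ * stateTime s i := by
  unfold stateTime
  rw [hs, Finset.mul_sum]
  rfl

theorem sysPath_mul (h : IsMoveSeq n s p) {N : ℕ} {ρ : ℝ} (hρ : 1 < ρ)
    (hs : ∀ i, s (i + N) = ρ • s i) (hp : ∀ i, p (i + N) = p i) {q : ℝ}
    (hq : stateTime s 0 ≤ q) :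
    sysPath s p (ρ * q) = ρ • sysPath s p q := by
  have hρ0 : 0 < ρ := by linarith
  obtain ⟨i, h1, h2⟩ := h.exists_right hq
  have ht1 := stateTime_add N ρ hs i
  have ht2 := stateTime_add N ρ hs (i + 1)
  have e : i + 1 + N = i + N + 1 := by ring
  rw [e] at ht2
  unfold sysPath
  rw [← srt_smul _ hρ0.le, h.rawPath_eq h1 h2.le,
    h.rawPath_eq (i := i + N) (by rw [ht1]; gcongr) (by rw [ht2]; gcongr), hs, hp, ht1,
    smul_add, smul_smul]
  congr 3
  ring

theorem isSelfSimilar (h : IsMoveSeq n s p) {N : ℕ} {ρ : ℝ} (hρ : 1 < ρ)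
    (hs : ∀ i, s (i + N) = ρ • s i) (hp : ∀ i, p (i + N) = p i) :
    IsSelfSimilar n (Ici (stateTime s 0)) (sysPath s p) := by
  refine ⟨not_bddAbove_Ici _, ρ, hρ, fun q hq => ⟨?_, h.sysPath_mul hρ hs hp hq⟩⟩
  have h0 := h.stateTime_pos 0
  have : stateTime s 0 ≤ q := hq
  exact mem_Ici.2 (by nlinarith)

end IsMoveSeq

/-! ### The spectrum point of a self-similar sequence of moves -/

/-- The value of `T` at the sorted and normalized point `v`. -/
def nval {n m : ℕ} (T : RVec n → RVec m) (v : RVec n) : RVec m := T ((∑ j, v j)⁻¹ • srt v)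

/-- The point at parameter `c` on the segment between consecutive states. -/
def segPt {n : ℕ} (s : ℕ → RVec n) (i : ℕ) (c : ℝ) : RVec n := (1 - c) • s i + c • s (i + 1)

/-- The values taken by the `j`-th coordinate of `nval T` along the segments of `s`. -/
def segVals {n m : ℕ} (T : RVec n → RVec m) (s : ℕ → RVec n) (j : Fin m) : Set ℝ :=
  {y | ∃ i c, 0 ≤ c ∧ c ≤ 1 ∧ y = nval T (segPt s i c) j}

/-- The coordinatewise infimum of `nval T` along the segments of `s`. -/
def segInf {n m : ℕ} (T : RVec n → RVec m) (s : ℕ → RVec n) : RVec m :=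
  fun j => sInf (segVals T s j)

theorem exists_lipschitz {n m : ℕ} {T : RVec n → RVec m} (hT : IsLinearMap ℝ T) :
    ∃ C : ℝ, 0 ≤ C ∧ ∀ (v w : RVec n) (d : ℝ), 0 ≤ d → (∀ j, |v j - w j| ≤ d) →
      ∀ i, |T v i - T w i| ≤ C * d := by
  set L : RVec n →L[ℝ] RVec m := LinearMap.toContinuousLinearMap (hT.mk' T) with hL
  refine ⟨‖L‖, norm_nonneg _, fun v w d hd h i => ?_⟩
  have h1 : ‖v - w‖ ≤ d := (pi_norm_le_iff_of_nonneg hd).2 h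
  have h2 : ‖L (v - w)‖ ≤ ‖L‖ * d := (L.le_opNorm _).trans (by gcongr)
  have h3 : L (v - w) = T v - T w := hT.map_sub v w
  rw [h3] at h2
  exact (norm_le_pi_norm (T v - T w) i).trans h2

theorem le_sum_of_nonneg {n : ℕ} {v : RVec n} (h : ∀ j, 0 ≤ v j) (j : Fin n) : v j ≤ ∑ k, v k :=
  Finset.single_le_sum (f := v) (fun j _ => h j) (Finset.mem_univ j)

theorem abs_normalized_sub_le {n : ℕ} {v w : RVec n} {d : ℝ} (hv : 0 < ∑ j, v j)
    (hw : ∀ j, 0 ≤ w j) (hw' : 0 < ∑ j, w j) (h : ∀ j, |w j - v j| ≤ d * ∑ k, v k) (j : Fin n) :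
    |((∑ k, w k)⁻¹ • srt w) j - ((∑ k, v k)⁻¹ • srt v) j| ≤ (n + 1) * d := by
  set W := ∑ k, w k
  set V := ∑ k, v k
  have h1 : |srt w j - srt v j| ≤ d * V := abs_srt_sub_le h j
  have h2 : |V - W| ≤ n * (d * V) := by
    rw [abs_sub_comm, ← Finset.sum_sub_distrib]
    refine (Finset.abs_sum_le_sum_abs _ _).trans ?_
    refine (Finset.sum_le_sum fun k _ => h k).trans ?_
    simp
  have h3 : 0 ≤ srt w j ∧ srt w j ≤ W := by
    obtain ⟨k, hk⟩ := exists_srt_eq w j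
    rw [hk]
    exact ⟨hw k, le_sum_of_nonneg hw k⟩
  have e : W⁻¹ * srt w j - V⁻¹ * srt v j =
      V⁻¹ * (srt w j - srt v j) + (W⁻¹ * srt w j) * (V⁻¹ * (V - W)) := by
    field_simp
    ring
  simp only [Pi.smul_apply, smul_eq_mul]
  rw [e]
  have h4 : |V⁻¹ * (srt w j - srt v j)| ≤ d := by
    rw [abs_mul, abs_of_pos (inv_pos.2 hv), inv_mul_le_iff₀ hv]
    linarith
  have h5 : |V⁻¹ * (V - W)| ≤ n * d := by
    rw [abs_mul, abs_of_pos (inv_pos.2 hv), inv_mul_le_iff₀ hv]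
    linarith
  have h6 : |W⁻¹ * srt w j| ≤ 1 := by
    rw [abs_of_nonneg (mul_nonneg (inv_nonneg.2 hw'.le) h3.1), inv_mul_le_iff₀ hw']
    linarith
  calc _ ≤ |V⁻¹ * (srt w j - srt v j)| + |W⁻¹ * srt w j * (V⁻¹ * (V - W))| := abs_add_le _ _
    _ ≤ d + 1 * (n * d) := by
        rw [abs_mul (W⁻¹ * srt w j)]
        gcongr
    _ = _ := by ring

theorem nval_smul {n m : ℕ} (T : RVec n → RVec m) (v : RVec n) {r : ℝ} (hr : 0 < r) :
    nval T (r • v) = nval T v := by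
  unfold nval
  rw [srt_smul v hr.le, smul_smul]
  congr 2
  simp only [Pi.smul_apply, smul_eq_mul, ← Finset.mul_sum, mul_inv]
  field_simp

theorem sum_segPt {n : ℕ} (s : ℕ → RVec n) (i : ℕ) (c : ℝ) :
    ∑ j, segPt s i c j = (1 - c) * stateTime s i + c * stateTime s (i + 1) := by
  simp [segPt, stateTime, Finset.sum_add_distrib, Finset.mul_sum]

theorem segPt_pos {n : ℕ} {s : ℕ → RVec n} (hs : ∀ i j, 0 < s i j) (i : ℕ) {c : ℝ} (hc : 0 ≤ c)
    (hc' : c ≤ 1) (j : Fin n) : 0 < segPt s i c j := by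
  have h1 := hs i j
  have h2 := hs (i + 1) j
  simp only [segPt, Pi.add_apply, Pi.smul_apply, smul_eq_mul]
  rcases hc.lt_or_eq with h | h
  · have : 0 ≤ (1 - c) * s i j := mul_nonneg (by linarith) h1.le
    have := mul_pos h h2
    linarith
  · rw [← h]; simpa using h1

theorem sum_pos_of_pos {n : ℕ} (j : Fin n) {v : RVec n} (h : ∀ j, 0 < v j) : 0 < ∑ j, v j :=
  Finset.sum_pos (fun j _ => h j) ⟨j, Finset.mem_univ j⟩

/-- Bound on the variation of `nval T` under a relative perturbation of the two end points of a
segment. -/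
theorem abs_nval_segPt_sub_le {n m : ℕ} {T : RVec n → RVec m} {C : ℝ}
    (hC : ∀ (v w : RVec n) (d : ℝ), 0 ≤ d → (∀ j, |v j - w j| ≤ d) →
      ∀ i, |T v i - T w i| ≤ C * d)
    {s s' : ℕ → RVec n} {i : ℕ} (hs : ∀ j, 0 ≤ s i j ∧ 0 ≤ s (i + 1) j)
    (hs0 : 0 < stateTime s i ∧ 0 < stateTime s (i + 1))
    (hs' : ∀ i j, 0 < s' i j) {u d : ℝ} (hu : 0 < u) (hd : 0 ≤ d)
    (h1 : ∀ j, |u * s' i j - s i j| ≤ d * stateTime s i)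
    (h2 : ∀ j, |u * s' (i + 1) j - s (i + 1) j| ≤ d * stateTime s (i + 1))
    {c : ℝ} (hc : 0 ≤ c) (hc' : c ≤ 1) (k : Fin m) :
    |nval T (segPt s' i c) k - nval T (segPt s i c) k| ≤ C * ((n + 1) * d) := by
  rcases Nat.eq_zero_or_pos n with hn | hn
  · subst hn
    simp [stateTime] at hs0
  rw [← nval_smul T (segPt s' i c) hu]
  have hpos : 0 < ∑ j, segPt s i c j := by
    rw [sum_segPt]
    rcases hc.lt_or_eq with h | h
    · have : 0 ≤ (1 - c) * stateTime s i := mul_nonneg (by linarith) hs0.1.le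
      have := mul_pos h hs0.2
      linarith
    · rw [← h]; simpa using hs0.1
  have hw : ∀ j, 0 < (u • segPt s' i c) j := fun j => mul_pos hu (segPt_pos hs' i hc hc' j)
  refine hC _ _ _ (by positivity) (fun j => ?_) k
  refine abs_normalized_sub_le hpos (fun j => (hw j).le) (sum_pos_of_pos ⟨0, hn⟩ hw) (fun j => ?_) j
  rw [sum_segPt]
  simp only [segPt, Pi.add_apply, Pi.smul_apply, smul_eq_mul]
  have e : u * ((1 - c) * s' i j + c * s' (i + 1) j) - ((1 - c) * s i j + c * s (i + 1) j) =
      (1 - c) * (u * s' i j - s i j) + c * (u * s' (i + 1) j - s (i + 1) j) := by ring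
  rw [e]
  refine (abs_add_le _ _).trans ?_
  rw [abs_mul, abs_mul, abs_of_nonneg hc, abs_of_nonneg (by linarith : 0 ≤ 1 - c)]
  have a1 := mul_le_mul_of_nonneg_left (h1 j) (by linarith : 0 ≤ 1 - c)
  have a2 := mul_le_mul_of_nonneg_left (h2 j) hc
  linarith

/-- The values of a linear map on normalized points are uniformly bounded. -/
theorem exists_bound {n m : ℕ} {T : RVec n → RVec m} (hT : IsLinearMap ℝ T) :
    ∃ B : ℝ, ∀ (v : RVec n), (∀ j, 0 ≤ v j) → ∀ k, |T ((∑ j, v j)⁻¹ • v) k| ≤ B := by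
  obtain ⟨C, -, hC⟩ := exists_lipschitz hT
  refine ⟨C * 1, fun v hv k => ?_⟩
  have h := hC ((∑ j, v j)⁻¹ • v) 0 1 zero_le_one (fun j => ?_) k
  · rwa [hT.map_zero, Pi.zero_apply, sub_zero] at h
  · have h0 : 0 ≤ ∑ j, v j := Finset.sum_nonneg fun j _ => hv j
    simp only [Pi.smul_apply, smul_eq_mul, Pi.zero_apply, sub_zero]
    rw [abs_of_nonneg (mul_nonneg (inv_nonneg.2 h0) (hv j))]
    rcases h0.lt_or_eq with h | h
    · rw [inv_mul_le_iff₀ h]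
      linarith [le_sum_of_nonneg hv j]
    · rw [← h]; simp

theorem abs_nval_le {n m : ℕ} {T : RVec n → RVec m} {B : ℝ}
    (hB : ∀ (v : RVec n), (∀ j, 0 ≤ v j) → ∀ k, |T ((∑ j, v j)⁻¹ • v) k| ≤ B)
    {v : RVec n} (hv : ∀ j, 0 ≤ v j) (k : Fin m) : |nval T v k| ≤ B := by
  unfold nval
  rw [← sum_srt]
  refine hB _ (fun j => ?_) k
  obtain ⟨i, hi⟩ := exists_srt_eq v j
  rw [hi]
  exact hv i

theorem segVals_nonempty {n m : ℕ} (T : RVec n → RVec m) (s : ℕ → RVec n) (j : Fin m) :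
    (segVals T s j).Nonempty :=
  ⟨_, 0, 0, le_rfl, zero_le_one, rfl⟩

theorem isGLB_segInf {n m : ℕ} {T : RVec n → RVec m} (hT : IsLinearMap ℝ T) {s : ℕ → RVec n}
    (hs : ∀ i j, 0 < s i j) (j : Fin m) : IsGLB (segVals T s j) (segInf T s j) := by
  refine isGLB_csInf (segVals_nonempty T s j) ?_
  obtain ⟨B, hB⟩ := exists_bound hT
  refine ⟨-B, ?_⟩
  rintro _ ⟨i, c, hc, hc', rfl⟩
  exact (abs_le.1 (abs_nval_le hB (fun j => (segPt_pos hs i hc hc' j).le) j)).1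

theorem abs_segInf_sub_le {n m : ℕ} {T : RVec n → RVec m} (hT : IsLinearMap ℝ T)
    {s s' : ℕ → RVec n} (hs : ∀ i j, 0 < s i j) (hs' : ∀ i j, 0 < s' i j) {e : ℝ} (j : Fin m)
    (h : ∀ i c, 0 ≤ c → c ≤ 1 → |nval T (segPt s' i c) j - nval T (segPt s i c) j| ≤ e) :
    |segInf T s' j - segInf T s j| ≤ e := by
  have g := isGLB_segInf hT hs j
  have g' := isGLB_segInf hT hs' j
  rw [abs_sub_le_iff]
  constructor
  · have : segInf T s' j - e ≤ segInf T s j := by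
      refine g.2 ?_
      rintro _ ⟨i, c, hc, hc', rfl⟩
      have h1 := g'.1 ⟨i, c, hc, hc', rfl⟩
      have h2 := (abs_sub_le_iff.1 (h i c hc hc')).1
      linarith
    linarith
  · have : segInf T s j - e ≤ segInf T s' j := by
      refine g'.2 ?_
      rintro _ ⟨i, c, hc, hc', rfl⟩
      have h1 := g.1 ⟨i, c, hc, hc', rfl⟩
      have h2 := (abs_sub_le_iff.1 (h i c hc hc')).2
      linarith
    linarith

namespace IsMoveSeq

variable {n m : ℕ} {s : ℕ → RVec n} {p : ℕ → Fin n}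

theorem rawPath_segPt (h : IsMoveSeq n s p) (i : ℕ) {c : ℝ} (hc : 0 ≤ c) (hc' : c ≤ 1) :
    rawPath s p ((1 - c) * stateTime s i + c * stateTime s (i + 1)) = segPt s i c := by
  have hlt := h.stateTime_lt i
  rw [h.rawPath_eq (i := i) (by nlinarith) (by nlinarith), segPt]
  conv_rhs => rw [h.state_succ i]
  module

theorem map_sysPath_div (h : IsMoveSeq n s p) {T : RVec n → RVec m} (hT : IsLinearMap ℝ T) {q : ℝ}
    (hq : stateTime s 0 ≤ q) (j : Fin m) :
    T (sysPath s p q) j / q = nval T (rawPath s p q) j := by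
  unfold nval
  rw [h.sum_rawPath hq, hT.map_smul, Pi.smul_apply, smul_eq_mul, div_eq_inv_mul]
  rfl

theorem map_sysPath_div_segPt (h : IsMoveSeq n s p) {T : RVec n → RVec m} (hT : IsLinearMap ℝ T)
    (i : ℕ) {c : ℝ} (hc : 0 ≤ c) (hc' : c ≤ 1) (j : Fin m) :
    T (sysPath s p ((1 - c) * stateTime s i + c * stateTime s (i + 1))) j /
      ((1 - c) * stateTime s i + c * stateTime s (i + 1)) = nval T (segPt s i c) j := by
  rw [h.map_sysPath_div hT, h.rawPath_segPt i hc hc']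
  have h1 := h.stateTime_strictMono.monotone (Nat.zero_le i)
  have h2 := h.stateTime_lt i
  nlinarith

theorem exists_segPt_eq (h : IsMoveSeq n s p) {q : ℝ} (hq : stateTime s 0 ≤ q) :
    ∃ i c, 0 ≤ c ∧ c ≤ 1 ∧ stateTime s i ≤ q ∧ rawPath s p q = segPt s i c := by
  obtain ⟨i, h1, h2⟩ := h.exists_right hq
  have hlt := h.stateTime_lt i
  have hne : stateTime s (i + 1) - stateTime s i ≠ 0 := by linarith
  have hc : 0 ≤ (q - stateTime s i) / (stateTime s (i + 1) - stateTime s i) :=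
    div_nonneg (by linarith) (by linarith)
  have hc' : (q - stateTime s i) / (stateTime s (i + 1) - stateTime s i) ≤ 1 := by
    rw [div_le_one (by linarith)]; linarith
  refine ⟨i, (q - stateTime s i) / (stateTime s (i + 1) - stateTime s i), hc, hc', h1, ?_⟩
  rw [← h.rawPath_segPt i hc hc']
  congr 1
  field_simp
  ring

theorem sysPath_div_bounded (h : IsMoveSeq n s p) {T : RVec n → RVec m} {B : ℝ}
    (hB : ∀ (v : RVec n), (∀ j, 0 ≤ v j) → ∀ k, |T ((∑ j, v j)⁻¹ • v) k| ≤ B)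
    (hT : IsLinearMap ℝ T) {q : ℝ} (hq : stateTime s 0 ≤ q) (j : Fin m) :
    |T (sysPath s p q) j / q| ≤ B := by
  rw [h.map_sysPath_div hT hq]
  exact abs_nval_le hB (fun j => (h.rawPath_pos hq j).le) j

theorem muT_eq_segInf (h : IsMoveSeq n s p) {N : ℕ} {ρ : ℝ} (hρ : 1 < ρ)
    (hs : ∀ i, s (i + N) = ρ • s i) (hp : ∀ i, p (i + N) = p i) {T : RVec n → RVec m}
    (hT : IsLinearMap ℝ T) :
    muT n m T (Ici (stateTime s 0)) (sysPath s p) = segInf T s := by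
  funext j
  have g := isGLB_segInf hT h.pos j
  obtain ⟨B, hB⟩ := exists_bound hT
  have hle : (atTop : Filter ℝ) ≤ 𝓟 (Ici (stateTime s 0)) :=
    le_principal_iff.2 (Ici_mem_atTop _)
  have hev : ∀ᶠ q in (atTop : Filter ℝ), stateTime s 0 ≤ q := eventually_ge_atTop _
  unfold muT
  rw [inf_eq_left.2 hle]
  have hbdd : IsBoundedUnder (· ≤ ·) atTop (fun q => T (sysPath s p q) j / q) :=
    isBoundedUnder_of_eventually_le (a := B)
      (hev.mono fun q hq => (abs_le.1 (h.sysPath_div_bounded hB hT hq j)).2)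
  have hbdd' : IsBoundedUnder (· ≥ ·) atTop (fun q => T (sysPath s p q) j / q) :=
    isBoundedUnder_of_eventually_ge (a := -B)
      (hev.mono fun q hq => (abs_le.1 (h.sysPath_div_bounded hB hT hq j)).1)
  refine le_antisymm (g.2 ?_) ?_
  · rintro _ ⟨i, c, hc, hc', rfl⟩
    have hρ0 : 0 < ρ := by linarith
    set q := (1 - c) * stateTime s i + c * stateTime s (i + 1) with hqdef
    have hq : stateTime s 0 ≤ q := by
      have h1 := h.stateTime_strictMono.monotone (Nat.zero_le i)
      have h2 := h.stateTime_lt i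
      nlinarith
    have hq0 : 0 < q := (h.stateTime_pos 0).trans_le hq
    have hk : ∀ k : ℕ, stateTime s 0 ≤ ρ ^ k * q ∧ sysPath s p (ρ ^ k * q) = ρ ^ k • sysPath s p q := by
      intro k
      induction k with
      | zero => simpa using hq
      | succ k ih =>
        rw [pow_succ', mul_assoc]
        refine ⟨?_, ?_⟩
        · have := h.stateTime_pos 0
          nlinarith [ih.1]
        · rw [h.sysPath_mul hρ hs hp ih.1, ih.2, smul_smul]
    have htend : Tendsto (fun k : ℕ => ρ ^ k * q) atTop atTop :=
      (tendsto_pow_atTop_atTop_of_one_lt hρ).atTop_mul_const hq0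
    refine liminf_le_of_frequently_le ?_ hbdd'
    refine htend.frequently (Filter.Eventually.frequently (Filter.Eventually.of_forall fun k => ?_))
    rw [(hk k).2, hT.map_smul, Pi.smul_apply, smul_eq_mul,
      mul_div_mul_left _ _ (pow_pos hρ0 k).ne', h.map_sysPath_div_segPt hT i hc hc']
  · refine le_liminf_of_le hbdd.isCoboundedUnder_ge ?_
    filter_upwards [hev] with q hq
    rw [h.map_sysPath_div hT hq]
    obtain ⟨i, c, hc, hc', -, hseg⟩ := h.exists_segPt_eq hq
    rw [hseg]
    exact g.1 ⟨i, c, hc, hc', rfl⟩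

end IsMoveSeq

/-! ### Contracting a self-similar sequence of moves -/

/-- A sequence of moves which is invariant, up to a dilation, under a shift of the indices. -/
structure IsPeriodicSeq (n : ℕ) (s : ℕ → RVec n) (p : ℕ → Fin n) (N : ℕ) (ρ : ℝ) : Prop where
  isMoveSeq : IsMoveSeq n s p
  one_lt : 1 < ρ
  state_add : ∀ i, s (i + N) = ρ • s i
  move_add : ∀ i, p (i + N) = p i

/-- The states obtained by raising all coordinates to the power `r`. -/
def powState {n : ℕ} (s : ℕ → RVec n) (r : ℝ) : ℕ → RVec n := fun i j => s i j ^ r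

theorem powState_pos {n : ℕ} {s : ℕ → RVec n} (hs : ∀ i j, 0 < s i j) (r : ℝ) (i : ℕ)
    (j : Fin n) : 0 < powState s r i j :=
  Real.rpow_pos_of_pos (hs i j) r

theorem powState_zero {n : ℕ} (s : ℕ → RVec n) : powState s 0 = fun _ _ => 1 := by
  funext i j
  simp [powState]

theorem powState_one {n : ℕ} (s : ℕ → RVec n) : powState s 1 = s := by
  funext i j
  simp [powState]

namespace IsPeriodicSeq

variable {n m : ℕ} {s : ℕ → RVec n} {p : ℕ → Fin n} {N : ℕ} {ρ : ℝ}

theorem period_pos (h : IsPeriodicSeq n s p N ρ) : 0 < N := by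
  rcases Nat.eq_zero_or_pos N with rfl | hN
  · have h1 := congrFun (h.state_add 0) (p 0)
    have h2 := h.isMoveSeq.pos 0 (p 0)
    simp only [add_zero, Pi.smul_apply, smul_eq_mul] at h1
    nlinarith [h.one_lt]
  · exact hN

theorem powState_add (h : IsPeriodicSeq n s p N ρ) (r : ℝ) (i : ℕ) :
    powState s r (i + N) = ρ ^ r • powState s r i := by
  funext j
  simp only [powState, h.state_add, Pi.smul_apply, smul_eq_mul]
  exact Real.mul_rpow (by linarith [h.one_lt]) (h.isMoveSeq.pos i j).le

theorem pow (h : IsPeriodicSeq n s p N ρ) {r : ℝ} (hr : 0 < r) :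
    IsPeriodicSeq n (powState s r) p N (ρ ^ r) where
  isMoveSeq :=
    { pos := powState_pos h.isMoveSeq.pos r
      step := fun i => Real.rpow_lt_rpow (h.isMoveSeq.pos _ _).le (h.isMoveSeq.step i) hr
      fix := fun i j hj => by simp only [powState, h.isMoveSeq.fix i j hj]
      legal := fun i => Real.rpow_le_rpow (h.isMoveSeq.pos _ _).le (h.isMoveSeq.legal i) hr.le
      unbounded := fun M => by
        have hM : 0 ≤ |M| := abs_nonneg M
        obtain ⟨i, hi⟩ := h.isMoveSeq.unbounded (|M| ^ r⁻¹)
        refine ⟨i, fun j => ?_⟩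
        have h1 := Real.rpow_lt_rpow (Real.rpow_nonneg hM _) (hi j) hr
        rw [Real.rpow_inv_rpow hM hr.ne'] at h1
        exact (le_abs_self M).trans_lt h1 }
  one_lt := Real.one_lt_rpow h.one_lt hr
  state_add := h.powState_add r
  move_add := h.move_add

theorem exists_close_powState (h : IsPeriodicSeq n s p N ρ) (r r' d : ℝ)
    (hclose : ∀ i ≤ N, ∀ j, |powState s r' i j - powState s r i j| ≤
      d * stateTime (powState s r) i) (i : ℕ) :
    ∃ u > 0, (∀ j, |u * powState s r' i j - powState s r i j| ≤ d * stateTime (powState s r) i) ∧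
      ∀ j, |u * powState s r' (i + 1) j - powState s r (i + 1) j| ≤
        d * stateTime (powState s r) (i + 1) := by
  have hN := h.period_pos
  have hρ : 0 < ρ := by linarith [h.one_lt]
  induction i using Nat.strong_induction_on with
  | _ i ih =>
    rcases lt_or_ge i N with hi | hi
    · refine ⟨1, one_pos, fun j => ?_, fun j => ?_⟩
      · rw [one_mul]; exact hclose i hi.le j
      · rw [one_mul]; exact hclose (i + 1) hi j
    · obtain ⟨k, rfl⟩ := Nat.exists_eq_add_of_le' hi
      obtain ⟨u, hu, h1, h2⟩ := ih k (by omega)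
      have ha : 0 < ρ ^ r := Real.rpow_pos_of_pos hρ r
      have hb : 0 < ρ ^ r' := Real.rpow_pos_of_pos hρ r'
      have key : ∀ l, (∀ j, |u * powState s r' l j - powState s r l j| ≤
          d * stateTime (powState s r) l) → ∀ j,
          |u * ρ ^ r / ρ ^ r' * powState s r' (l + N) j - powState s r (l + N) j| ≤
            d * stateTime (powState s r) (l + N) := by
        intro l hl j
        rw [IsMoveSeq.stateTime_add N (ρ ^ r) (h.powState_add r), h.powState_add,
          h.powState_add, Pi.smul_apply, Pi.smul_apply, smul_eq_mul, smul_eq_mul]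
        have e : u * ρ ^ r / ρ ^ r' * (ρ ^ r' * powState s r' l j) - ρ ^ r * powState s r l j =
            ρ ^ r * (u * powState s r' l j - powState s r l j) := by
          field_simp
        rw [e, abs_mul, abs_of_pos ha]
        calc _ ≤ ρ ^ r * (d * stateTime (powState s r) l) := by gcongr; exact hl j
          _ = _ := by ring
      refine ⟨u * ρ ^ r / ρ ^ r', by positivity, key k h1, ?_⟩
      have e : k + N + 1 = k + 1 + N := by ring
      rw [e]
      exact key (k + 1) h2

theorem continuous_segInf_powState (h : IsPeriodicSeq n s p N ρ) {T : RVec n → RVec m}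
    (hT : IsLinearMap ℝ T) : Continuous fun r => segInf T (powState s r) := by
  rw [continuous_iff_continuousAt]
  intro r
  rw [ContinuousAt, tendsto_pi_nhds]
  intro k
  rw [Metric.tendsto_nhds]
  intro ε hε
  obtain ⟨C, hC0, hC⟩ := exists_lipschitz hT
  have hpos := powState_pos h.isMoveSeq.pos
  have htime : ∀ r i, 0 < stateTime (powState s r) i := fun r i =>
    sum_pos_of_pos (p 0) (hpos r i)
  set d : ℝ := ε / (2 * (C * (n + 1) + 1)) with hd
  have hd0 : 0 < d := by positivity
  have hev : ∀ᶠ r' in 𝓝 r, ∀ i ∈ Finset.range (N + 1), ∀ j,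
      |powState s r' i j - powState s r i j| < d * stateTime (powState s r) i := by
    rw [Filter.eventually_all_finset]
    intro i _
    rw [Filter.eventually_all]
    intro j
    have hcont : Continuous fun r' => |powState s r' i j - powState s r i j| :=
      ((continuous_const.rpow continuous_id fun _ => Or.inl (h.isMoveSeq.pos i j).ne').sub
        continuous_const).abs
    have := hcont.tendsto r
    simp only [sub_self, abs_zero] at this
    exact this.eventually_lt_const (mul_pos hd0 (htime r i))
  filter_upwards [hev] with r' hr'
  rw [Real.dist_eq]
  refine (abs_segInf_sub_le hT (hpos r) (hpos r') (e := C * ((n + 1) * d)) k ?_).trans_lt ?_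
  · intro i c hc hc'
    obtain ⟨u, hu, h1, h2⟩ := h.exists_close_powState r r' d
      (fun i hi j => (hr' i (Finset.mem_range.2 (by omega)) j).le) i
    exact abs_nval_segPt_sub_le hC (fun j => ⟨(hpos r i j).le, (hpos r (i + 1) j).le⟩)
      ⟨htime r i, htime r (i + 1)⟩ (hpos r') hu hd0.le h1 h2 hc hc' k
  · have : C * ((n + 1) * d) = ε * (C * (n + 1) / (2 * (C * (n + 1) + 1))) := by
      rw [hd]; ring
    rw [this]
    have h1 : C * (n + 1) / (2 * (C * (n + 1) + 1)) < 1 := by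
      rw [div_lt_one (by positivity)]
      have : 0 ≤ C * ((n : ℝ) + 1) := by positivity
      linarith
    nlinarith

end IsPeriodicSeq

/-! ### A system with all components asymptotically equal -/

/-- The states of the sequence of moves in which each move lifts the lowest of `n` consecutive
integers above the highest. -/
def cyclicState (n : ℕ) : ℕ → RVec n := fun i j => (((i : ℤ) + 1 + ((j : ℤ) - i) % n : ℤ) : ℝ)

theorem isMoveSeq_cyclic {n : ℕ} (hn : 0 < n) :
    IsMoveSeq n (cyclicState n) (fun i => ⟨i % n, Nat.mod_lt i hn⟩) := by
  have hn' : (0 : ℤ) < n := by exact_mod_cast hn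
  have hself : ∀ i : ℕ, ((((i % n : ℕ) : ℤ)) - i) % n = 0 := by
    intro i
    push_cast
    rw [Int.emod_sub_emod]
    simp
  have hsucc : ∀ i : ℕ, ((((i % n : ℕ) : ℤ)) - ((i + 1 : ℕ) : ℤ)) % n = n - 1 := by
    intro i
    push_cast
    rw [Int.emod_sub_emod, show (i : ℤ) - (i + 1) = -1 by ring, Int.neg_emod]
    by_cases h1 : n = 1
    · subst h1; simp
    · have h2 : ¬ (n : ℤ) ∣ 1 := by
        intro h
        have := Int.le_of_dvd one_pos h
        omega
      rw [if_neg h2, Int.emod_eq_of_lt (by norm_num) (by omega)]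
      simp
  have hnn : ∀ (i : ℕ) (j : Fin n), 0 ≤ ((j : ℤ) - i) % n := fun i j => Int.emod_nonneg _ hn'.ne'
  have hlt : ∀ (i : ℕ) (j : Fin n), ((j : ℤ) - i) % n < n := fun i j => Int.emod_lt_of_pos _ hn'
  refine ⟨fun i j => ?_, fun i => ?_, fun i j hj => ?_, fun i => ?_, fun M => ?_⟩
  · have := hnn i j
    unfold cyclicState
    exact_mod_cast (by omega : (0 : ℤ) < (i : ℤ) + 1 + ((j : ℤ) - i) % n)
  · simp only [cyclicState]
    rw [hself, hsucc]
    push_cast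
    have : (1 : ℝ) ≤ n := by exact_mod_cast hn
    linarith
  · simp only [cyclicState]
    have h0 : ((j : ℤ) - i) % n ≠ 0 := by
      intro h0
      apply hj
      have h2 : ((j : ℕ) : ℤ) % n = (i : ℤ) % n := Int.emod_eq_emod_iff_emod_sub_eq_zero.2 h0
      have h3 : (j : ℕ) % n = i % n := by exact_mod_cast h2
      rw [Nat.mod_eq_of_lt j.2] at h3
      exact Fin.ext h3
    have h1 : ((j : ℤ) - ((i + 1 : ℕ) : ℤ)) % n = ((j : ℤ) - i) % n - 1 := by
      have hb := hnn i j
      have hc := hlt i j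
      have e : (j : ℤ) - ((i + 1 : ℕ) : ℤ) = (((j : ℤ) - i) % n - 1) + n * (((j : ℤ) - i) / n) := by
        have := Int.emod_add_mul_ediv ((j : ℤ) - i) n
        push_cast
        linarith
      rw [e, Int.add_mul_emod_self_left]
      exact Int.emod_eq_of_lt (by omega) (by omega)
    rw [h1]
    push_cast
    ring
  · simp only [cyclicState]
    rw [hself, hsucc]
    have : (1 : ℝ) ≤ n := by exact_mod_cast hn
    push_cast
    linarith
  · obtain ⟨i, hi⟩ := exists_nat_gt M
    refine ⟨i, fun j => hi.trans_le ?_⟩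
    have := hnn i j
    unfold cyclicState
    exact_mod_cast (by omega : (i : ℤ) ≤ (i : ℤ) + 1 + ((j : ℤ) - i) % n)

theorem cyclicState_close {n : ℕ} (hn : 0 < n) (i : ℕ) (j : Fin n) :
    (i : ℝ) + 1 ≤ cyclicState n i j ∧ cyclicState n i j ≤ i + 1 + n := by
  have hn' : (0 : ℤ) < n := by exact_mod_cast hn
  have h1 := Int.emod_nonneg ((j : ℤ) - i) hn'.ne'
  have h2 := Int.emod_lt_of_pos ((j : ℤ) - i) hn'
  unfold cyclicState
  constructor
  · exact_mod_cast (by omega : (i : ℤ) + 1 ≤ (i : ℤ) + 1 + ((j : ℤ) - i) % n)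
  · exact_mod_cast (by omega : (i : ℤ) + 1 + ((j : ℤ) - i) % n ≤ (i : ℤ) + 1 + n)

theorem segPt_one {n : ℕ} (i : ℕ) (c : ℝ) :
    segPt (fun _ _ => 1 : ℕ → RVec n) i c = fun _ => 1 := by
  funext j
  simp [segPt]

theorem segInf_one {n m : ℕ} (T : RVec n → RVec m) :
    segInf T (fun _ _ => 1 : ℕ → RVec n) = nval T (fun _ => 1) := by
  funext j
  have : segVals T (fun _ _ => 1 : ℕ → RVec n) j = {nval T (fun _ => 1) j} := by
    ext y
    simp only [segVals, segPt_one, mem_ofPred_eq, mem_singleton_iff]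
    constructor
    · rintro ⟨-, -, -, -, h⟩
      exact h
    · intro h
      exact ⟨0, 0, le_rfl, zero_le_one, h⟩
  rw [segInf, this, csInf_singleton]

theorem muT_cyclic {n m : ℕ} (hn : 0 < n) {T : RVec n → RVec m} (hT : IsLinearMap ℝ T) :
    muT n m T (Ici (stateTime (cyclicState n) 0))
      (sysPath (cyclicState n) (fun i => ⟨i % n, Nat.mod_lt i hn⟩)) = nval T (fun _ => 1) := by
  have h := isMoveSeq_cyclic hn
  set s := cyclicState n
  set p : ℕ → Fin n := fun i => ⟨i % n, Nat.mod_lt i hn⟩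
  funext j
  have hle : (atTop : Filter ℝ) ≤ 𝓟 (Ici (stateTime s 0)) :=
    le_principal_iff.2 (Ici_mem_atTop _)
  unfold muT
  rw [inf_eq_left.2 hle]
  refine Tendsto.liminf_eq ?_
  rw [Metric.tendsto_nhds]
  intro ε hε
  obtain ⟨C, hC0, hC⟩ := exists_lipschitz hT
  set d : ℝ := ε / (2 * (C * (n + 1) + 1)) with hd
  have hd0 : 0 < d := by positivity
  have hn1 : (1 : ℝ) ≤ n := by exact_mod_cast hn
  obtain ⟨i0, hi0⟩ := exists_nat_gt ((n + 1) / d)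
  filter_upwards [eventually_ge_atTop (stateTime s 0), eventually_gt_atTop (stateTime s (i0 + 1))]
    with q hq hq'
  obtain ⟨i, h1, h2⟩ := h.exists_right hq
  rw [h.map_sysPath_div hT hq]
  have hi : i0 ≤ i := by
    have := h.stateTime_strictMono.lt_iff_lt.1 (hq'.trans h2)
    omega
  have hi' : (i0 : ℝ) ≤ i := by exact_mod_cast hi
  have hb : (n + 1 : ℝ) ≤ d * (i + 1) := by
    rw [div_lt_iff₀ hd0] at hi0
    nlinarith
  have hlt := h.stateTime_lt i
  have hc : 0 ≤ (q - stateTime s i) / (stateTime s (i + 1) - stateTime s i) :=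
    div_nonneg (by linarith) (by linarith)
  have hc' : (q - stateTime s i) / (stateTime s (i + 1) - stateTime s i) ≤ 1 := by
    rw [div_le_one (by linarith)]; linarith
  have hraw := h.rawPath_segPt i hc hc'
  have hqe : (1 - (q - stateTime s i) / (stateTime s (i + 1) - stateTime s i)) * stateTime s i +
      (q - stateTime s i) / (stateTime s (i + 1) - stateTime s i) * stateTime s (i + 1) = q := by
    have hne : stateTime s (i + 1) - stateTime s i ≠ 0 := by linarith
    field_simp
    ring
  rw [hqe] at hraw
  rw [hraw, Real.dist_eq, ← segPt_one i ((q - stateTime s i) / (stateTime s (i + 1) - stateTime s i))]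
  have htime : ∀ i, stateTime (fun _ _ => 1 : ℕ → RVec n) i = n := by
    intro i; simp [stateTime]
  have hdn : d ≤ d * n := by nlinarith
  have hi1 : (0 : ℝ) < i + 1 := by positivity
  refine (abs_nval_segPt_sub_le hC (s := fun _ _ => 1) (s' := s) (d := d) (u := ((i : ℝ) + 1)⁻¹)
    (fun j => ⟨zero_le_one, zero_le_one⟩) ?_ h.pos
    (by positivity) hd0.le ?_ ?_ hc hc' j).trans_lt ?_
  · rw [htime, htime]; exact ⟨by linarith, by linarith⟩
  · intro j
    rw [htime]
    obtain ⟨a1, a2⟩ := cyclicState_close hn i j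
    have e : ((i : ℝ) + 1)⁻¹ * s i j - 1 = ((i : ℝ) + 1)⁻¹ * (s i j - (i + 1)) := by
      field_simp
    rw [e, abs_of_nonneg (mul_nonneg (by positivity) (by linarith)), inv_mul_le_iff₀ hi1]
    nlinarith
  · intro j
    rw [htime]
    obtain ⟨a1, a2⟩ := cyclicState_close hn (i + 1) j
    push_cast at a1 a2
    have e : ((i : ℝ) + 1)⁻¹ * s (i + 1) j - 1 = ((i : ℝ) + 1)⁻¹ * (s (i + 1) j - (i + 1)) := by
      field_simp
    rw [e, abs_of_nonneg (mul_nonneg (by positivity) (by linarith)), inv_mul_le_iff₀ hi1]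
    nlinarith
  · have : C * ((n + 1) * d) = ε * (C * (n + 1) / (2 * (C * (n + 1) + 1))) := by
      rw [hd]; ring
    rw [this]
    have h1 : C * (n + 1) / (2 * (C * (n + 1) + 1)) < 1 := by
      rw [div_lt_one (by positivity)]
      have : 0 ≤ C * ((n : ℝ) + 1) := by positivity
      linarith
    nlinarith

/-! ### The connected core of the spectrum -/

theorem exists_preconnected_core {n m : ℕ} (hn : 0 < n) {T : RVec n → RVec m}
    (hT : IsLinearMap ℝ T) :
    ∃ D : Set (RVec m), IsPreconnected D ∧ D.Nonempty ∧
      (∀ s p N ρ, IsPeriodicSeq n s p N ρ → segInf T s ∈ D) ∧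
      D ⊆ {y | ∃ I P, IsProperSys n I P ∧ muT n m T I P = y} := by
  set K : Set (Set (RVec m)) := insert {nval T (fun _ => 1)}
    {A | ∃ s p N ρ, IsPeriodicSeq n s p N ρ ∧ A = (fun r => segInf T (powState s r)) '' Icc 0 1}
    with hK
  refine ⟨⋃₀ K, isPreconnected_sUnion (nval T fun _ => 1) K ?_ ?_,
    ⟨_, {nval T fun _ => 1}, mem_insert _ _, rfl⟩, ?_, ?_⟩
  · rintro A (rfl | ⟨s, p, N, ρ, h, rfl⟩)
    · rfl
    · refine ⟨0, ⟨le_rfl, zero_le_one⟩, ?_⟩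
      simp only [powState_zero]
      exact segInf_one T
  · rintro A (rfl | ⟨s, p, N, ρ, h, rfl⟩)
    · exact isPreconnected_singleton
    · exact isPreconnected_Icc.image _ (h.continuous_segInf_powState hT).continuousOn
  · intro s p N ρ h
    refine ⟨_, Or.inr ⟨s, p, N, ρ, h, rfl⟩, 1, ⟨zero_le_one, le_rfl⟩, ?_⟩
    simp only [powState_one]
  · have hone : nval T (fun _ => 1) ∈
        {y | ∃ I P, IsProperSys n I P ∧ muT n m T I P = y} :=
      ⟨_, _, (isMoveSeq_cyclic hn).isProperSys, muT_cyclic hn hT⟩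
    rintro y ⟨A, rfl | ⟨s, p, N, ρ, h, rfl⟩, hy⟩
    · rw [mem_singleton_iff.1 hy]; exact hone
    · obtain ⟨r, ⟨hr0, hr1⟩, rfl⟩ := hy
      rcases hr0.lt_or_eq with hr | rfl
      · have h' := h.pow hr
        exact ⟨_, _, h'.isMoveSeq.isProperSys,
          h'.isMoveSeq.muT_eq_segInf h'.one_lt h'.state_add h'.move_add hT⟩
      · simp only [powState_zero]
        rw [segInf_one]
        exact hone

/-! ### Closing a finite legal path into a periodic one -/

/-- A finite path of integral states, moving one coordinate at a time, whose last state is the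
first one dilated by `ρ`, and which can be legally repeated. -/
structure IsClosedPath (n : ℕ) (c : ℕ → Fin n → ℕ) (q : ℕ → Fin n) (N ρ : ℕ) : Prop where
  length_pos : 0 < N
  one_lt : 1 < ρ
  pos : ∀ j, 0 < c 0 j
  step : ∀ i < N, c i (q i) < c (i + 1) (q i)
  fix : ∀ i < N, ∀ j ≠ q i, c (i + 1) j = c i j
  legal : ∀ i, i + 1 < N → c (i + 1) (q (i + 1)) ≤ c (i + 1) (q i)
  closed : ∀ j, c N j = ρ * c 0 j
  wrap : q (N - 1) = q 0
  inj : ∀ i < N, Function.Injective (c i)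

/-- The states of the periodic continuation of a closed path. -/
def repeatState {n : ℕ} (c : ℕ → Fin n → ℕ) (N ρ : ℕ) : ℕ → RVec n :=
  fun i j => ((ρ ^ (i / N) * c (i % N) j : ℕ) : ℝ)

namespace IsClosedPath

variable {n : ℕ} {c : ℕ → Fin n → ℕ} {q : ℕ → Fin n} {N ρ : ℕ}

theorem repeatState_succ (h : IsClosedPath n c q N ρ) (i : ℕ) (j : Fin n) :
    repeatState c N ρ (i + 1) j = ((ρ ^ (i / N) * c (i % N + 1) j : ℕ) : ℝ) := by
  have hN := h.length_pos
  have hlt := Nat.mod_lt i hN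
  have hi := Nat.div_add_mod i N
  unfold repeatState
  rcases Nat.lt_or_ge (i % N + 1) N with h1 | h1
  · have e : i + 1 = (i % N + 1) + N * (i / N) := by omega
    rw [e, Nat.add_mul_div_left _ _ hN, Nat.add_mul_mod_self_left, Nat.div_eq_of_lt h1,
      Nat.mod_eq_of_lt h1, zero_add]
  · have e1 : i % N + 1 = N := by omega
    have e : i + 1 = 0 + N * (i / N + 1) := by rw [mul_add]; omega
    rw [e1, h.closed, e, Nat.add_mul_div_left _ _ hN, Nat.add_mul_mod_self_left]
    simp only [Nat.zero_div, Nat.zero_mod, zero_add, pow_succ, mul_assoc]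

theorem mono (h : IsClosedPath n c q N ρ) {i : ℕ} (hi : i < N) (j : Fin n) :
    c i j ≤ c (i + 1) j := by
  by_cases hj : j = q i
  · subst hj; exact (h.step i hi).le
  · exact (h.fix i hi j hj).ge

theorem pos_of_le (h : IsClosedPath n c q N ρ) (i : ℕ) (hi : i ≤ N) (j : Fin n) : 0 < c i j := by
  induction i with
  | zero => exact h.pos j
  | succ i ih => exact (ih (by omega)).trans_le (h.mono (by omega) j)

theorem pow_pos (h : IsClosedPath n c q N ρ) (k : ℕ) : 0 < ρ ^ k :=
  Nat.pow_pos (zero_lt_one.trans h.one_lt)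

theorem isMoveSeq (h : IsClosedPath n c q N ρ) :
    IsMoveSeq n (repeatState c N ρ) (fun i => q (i % N)) := by
  have hN := h.length_pos
  refine ⟨fun i j => ?_, fun i => ?_, fun i j hj => ?_, fun i => ?_, fun M => ?_⟩
  · exact Nat.cast_pos.2 (Nat.mul_pos (h.pow_pos _) (h.pos_of_le _ (Nat.mod_lt i hN).le j))
  · rw [h.repeatState_succ]
    exact Nat.cast_lt.2 (Nat.mul_lt_mul_of_pos_left (h.step _ (Nat.mod_lt i hN)) (h.pow_pos _))
  · rw [h.repeatState_succ, h.fix _ (Nat.mod_lt i hN) j hj]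
    rfl
  · rw [h.repeatState_succ, h.repeatState_succ]
    refine Nat.cast_le.2 (Nat.mul_le_mul_left _ ?_)
    have hlt := Nat.mod_lt i hN
    rcases Nat.lt_or_ge (i % N + 1) N with h1 | h1
    · have e : (i + 1) % N = i % N + 1 := by
        rw [Nat.add_mod, Nat.mod_eq_of_lt (show 1 < N by omega), Nat.mod_eq_of_lt h1]
      rw [e]
      exact h.legal _ h1
    · have e1 : i % N = N - 1 := by omega
      have e : (i + 1) % N = 0 := by
        have hi := Nat.div_add_mod i N
        have e : i + 1 = 0 + N * (i / N + 1) := by rw [mul_add]; omega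
        rw [e, Nat.add_mul_mod_self_left, Nat.zero_mod]
      rw [e, e1, h.wrap]
  · obtain ⟨k, hk⟩ := exists_nat_gt M
    refine ⟨N * k, fun j => hk.trans_le (Nat.cast_le.2 ?_)⟩
    rw [Nat.mul_div_cancel_left _ hN, Nat.mul_mod_right]
    calc k ≤ ρ ^ k := (Nat.lt_pow_self h.one_lt).le
      _ ≤ ρ ^ k * c 0 j := Nat.le_mul_of_pos_right _ (h.pos j)

theorem isPeriodicSeq (h : IsClosedPath n c q N ρ) :
    IsPeriodicSeq n (repeatState c N ρ) (fun i => q (i % N)) N ρ := by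
  have hN := h.length_pos
  refine ⟨h.isMoveSeq, by exact_mod_cast h.one_lt, fun i => ?_, fun i => ?_⟩
  · ext j
    simp only [repeatState, Pi.smul_apply, smul_eq_mul]
    rw [Nat.add_div_right _ hN, Nat.add_mod_right, pow_succ]
    push_cast
    ring
  · simp only [Nat.add_mod_right]

theorem injective_repeatState (h : IsClosedPath n c q N ρ) (i : ℕ) :
    Function.Injective (repeatState c N ρ i) := by
  intro j k hjk
  have := Nat.cast_injective (R := ℝ) hjk
  exact h.inj _ (Nat.mod_lt i h.length_pos) (Nat.eq_of_mul_eq_mul_left (h.pow_pos _) this)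

end IsClosedPath

/-- The step after which coordinate `j` last moved before the `i`-th state, or `0`. -/
def lastMove {n : ℕ} (p : ℕ → Fin n) : ℕ → Fin n → ℕ
  | 0, _ => 0
  | i + 1, j => if j = p i then i + 1 else lastMove p i j

theorem lastMove_le {n : ℕ} (p : ℕ → Fin n) (i : ℕ) (j : Fin n) : lastMove p i j ≤ i := by
  induction i with
  | zero => exact le_rfl
  | succ i ih => simp only [lastMove]; split_ifs <;> omega

theorem lastMove_mono {n : ℕ} (p : ℕ → Fin n) (j : Fin n) : Monotone fun i => lastMove p i j := by
  refine monotone_nat_of_le_succ fun i => ?_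
  have := lastMove_le p i j
  simp only [lastMove]; split_ifs <;> omega

theorem move_of_lastMove {n : ℕ} (p : ℕ → Fin n) (i : ℕ) (j : Fin n) (h : lastMove p i j ≠ 0) :
    p (lastMove p i j - 1) = j := by
  induction i with
  | zero => exact absurd rfl h
  | succ i ih =>
    simp only [lastMove] at h ⊢
    split_ifs at h ⊢ with h1
    · simpa using h1.symm
    · exact ih h

theorem lt_lastMove {n : ℕ} (p : ℕ → Fin n) {i N : ℕ} (h : i < N) :
    i < lastMove p N (p i) := by
  have h1 : lastMove p (i + 1) (p i) ≤ lastMove p N (p i) := lastMove_mono p (p i) h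
  simp only [lastMove, if_true] at h1
  omega

/-- Integral states with distinct coordinates following a path with integral states. -/
def spreadState {n : ℕ} (a : ℕ → Fin n → ℕ) (p : ℕ → Fin n) (K i : ℕ) (j : Fin n) : ℕ :=
  K * (a i j + if lastMove p i j = 0 then (j : ℕ) else n) + lastMove p i j

/-- The path `spreadState` continued until all its coordinates reach the dilation of the initial
state by `ρ`; the coordinates of index at least `j₀` reach it on their last move. -/
def closeState {n : ℕ} (a : ℕ → Fin n → ℕ) (p : ℕ → Fin n) (N ρ : ℕ) (j₀ : Fin n) (i : ℕ)
    (j : Fin n) : ℕ :=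
  if (j₀ : ℕ) ≤ j + (i - N) ∧ lastMove p (min i N) j = lastMove p N j then
    ρ * spreadState a p (N + 1) 0 j
  else spreadState a p (N + 1) (min i N) j

/-- The coordinates moved along `closeState`. -/
def closeMove {n : ℕ} (p : ℕ → Fin n) (N : ℕ) (j₀ : Fin n) (i : ℕ) : Fin n :=
  if i < N then p i else ⟨j₀ - (i - N) - 1, by omega⟩

section Closing

variable {n : ℕ} {a : ℕ → Fin n → ℕ} {p : ℕ → Fin n} {N ρ : ℕ} {j₀ : Fin n}

theorem spreadState_fix (hfix : ∀ i < N, ∀ j ≠ p i, a (i + 1) j = a i j) (K : ℕ) {i : ℕ}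
    (hi : i < N) {j : Fin n} (hj : j ≠ p i) :
    spreadState a p K (i + 1) j = spreadState a p K i j := by
  simp only [spreadState, lastMove, if_neg hj, hfix i hi j hj]

theorem spreadState_step (hstep : ∀ i < N, a i (p i) ≤ a (i + 1) (p i)) (K : ℕ) {i : ℕ}
    (hi : i < N) : spreadState a p K i (p i) < spreadState a p K (i + 1) (p i) := by
  have h1 := lastMove_le p i (p i)
  have h2 := hstep i hi
  simp only [spreadState, lastMove, if_true, Nat.succ_ne_zero, if_false]
  have : K * (a i (p i) + if lastMove p i (p i) = 0 then (p i : ℕ) else n) ≤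
      K * (a (i + 1) (p i) + n) := by
    apply Nat.mul_le_mul_left
    split_ifs
    · have := (p i).2; omega
    · omega
  omega

theorem spreadState_mono (hfix : ∀ i < N, ∀ j ≠ p i, a (i + 1) j = a i j)
    (hstep : ∀ i < N, a i (p i) ≤ a (i + 1) (p i)) (K : ℕ) {i : ℕ} (hi : i ≤ N) (j : Fin n) :
    spreadState a p K i j ≤ spreadState a p K N j := by
  induction N, hi using Nat.le_induction with
  | base => exact le_rfl
  | succ N hN ih =>
    refine (ih (fun i hi => hfix i (by omega)) (fun i hi => hstep i (by omega))).trans ?_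
    by_cases hj : j = p N
    · subst hj; exact (spreadState_step hstep K (Nat.lt_succ_self N)).le
    · exact (spreadState_fix hfix K (Nat.lt_succ_self N) hj).ge

theorem spreadState_legal (hlegal : ∀ i, i + 1 < N → a (i + 1) (p (i + 1)) ≤ a (i + 1) (p i))
    (K : ℕ) {i : ℕ} (hi : i + 1 < N) :
    spreadState a p K (i + 1) (p (i + 1)) ≤ spreadState a p K (i + 1) (p i) := by
  have h1 := lastMove_le p (i + 1) (p (i + 1))
  have h2 := hlegal i hi
  have h3 : lastMove p (i + 1) (p i) = i + 1 := by simp [lastMove]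
  simp only [spreadState]
  rw [h3]
  have : K * (a (i + 1) (p (i + 1)) +
      if lastMove p (i + 1) (p (i + 1)) = 0 then (p (i + 1) : ℕ) else n) ≤
      K * (a (i + 1) (p i) + n) := by
    apply Nat.mul_le_mul_left
    split_ifs
    · have := (p (i + 1)).2; omega
    · omega
  simp only [Nat.succ_ne_zero, if_false]
  omega

theorem spreadState_le (K i : ℕ) (j : Fin n) :
    K * a i j ≤ spreadState a p K i j :=
  (Nat.mul_le_mul_left K (Nat.le_add_right _ _)).trans (Nat.le_add_right _ _)

theorem spreadState_lt {K i : ℕ} (hK : i < K) (j : Fin n) :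
    spreadState a p K i j < K * (a i j + n + 1) := by
  have h1 := lastMove_le p i j
  have : K * (a i j + if lastMove p i j = 0 then (j : ℕ) else n) ≤ K * (a i j + n) := by
    apply Nat.mul_le_mul_left
    split_ifs
    · have := j.2; omega
    · omega
  rw [mul_add K _ 1]
  unfold spreadState
  omega

theorem spreadState_zero (K : ℕ) (j : Fin n) : spreadState a p K 0 j = K * (a 0 j + j) := by
  simp [spreadState, lastMove]

theorem strictMono_spreadState_zero (hmono : Monotone (a 0)) {K : ℕ} (hK : 0 < K) :
    StrictMono (spreadState a p K 0) := by
  intro j k hjk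
  rw [spreadState_zero, spreadState_zero]
  have := hmono hjk.le
  have : (j : ℕ) < k := hjk
  exact Nat.mul_lt_mul_of_pos_left (by omega) hK

theorem eq_of_lastMove_eq_zero (hfix : ∀ i < N, ∀ j ≠ p i, a (i + 1) j = a i j) {i : ℕ}
    (hi : i ≤ N) {j : Fin n} (h : lastMove p i j = 0) (K : ℕ) :
    spreadState a p K i j = spreadState a p K 0 j := by
  induction i with
  | zero => rfl
  | succ i ih =>
    simp only [lastMove] at h
    split_ifs at h with h1
    rw [spreadState_fix hfix K (by omega) h1, ih (by omega) h]

theorem spreadState_mod {K i : ℕ} (hK : i < K) (j : Fin n) :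
    spreadState a p K i j % K = lastMove p i j := by
  rw [spreadState, Nat.mul_add_mod, Nat.mod_eq_of_lt ((lastMove_le p i j).trans_lt hK)]

theorem injective_spreadState (hfix : ∀ i < N, ∀ j ≠ p i, a (i + 1) j = a i j)
    (hmono : Monotone (a 0)) {K i : ℕ} (hi : i ≤ N) (hK : N < K) :
    Function.Injective (spreadState a p K i) := by
  intro j k hjk
  have h1 : lastMove p i j = lastMove p i k := by
    rw [← spreadState_mod (a := a) (hi.trans_lt hK), hjk, spreadState_mod (hi.trans_lt hK)]
  by_cases h0 : lastMove p i j = 0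
  · rw [eq_of_lastMove_eq_zero hfix hi h0, eq_of_lastMove_eq_zero hfix hi (h1 ▸ h0)] at hjk
    exact (strictMono_spreadState_zero hmono (by omega)).injective hjk
  · rw [← move_of_lastMove p i j h0, h1, move_of_lastMove p i k (h1 ▸ h0)]

theorem isClosedPath_close (hN : 0 < N) (hfix : ∀ i < N, ∀ j ≠ p i, a (i + 1) j = a i j)
    (hstep : ∀ i < N, a i (p i) ≤ a (i + 1) (p i))
    (hlegal : ∀ i, i + 1 < N → a (i + 1) (p (i + 1)) ≤ a (i + 1) (p i))
    (hmono : Monotone (a 0)) (hfirst : (p 0 : ℕ) = 0) (hlast : p (N - 1) = j₀)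
    (hmoved : ∀ j, j₀ ≤ j → ∃ i < N, p i = j) (hbig : ∀ j, a N j + n + 1 ≤ ρ * a 0 j)
    (hbig' : ∀ j k, a 0 k + n < ρ * a 0 j) :
    IsClosedPath n (closeState a p N ρ j₀) (closeMove p N j₀) (N + j₀) ρ := by
  have hz : ∀ j, spreadState a p (N + 1) N j < ρ * spreadState a p (N + 1) 0 j := fun j =>
    calc spreadState a p (N + 1) N j < (N + 1) * (a N j + n + 1) :=
          spreadState_lt (Nat.lt_succ_self N) j
      _ ≤ (N + 1) * (ρ * a 0 j) := Nat.mul_le_mul_left _ (hbig j)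
      _ = ρ * ((N + 1) * a 0 j) := by ring
      _ ≤ _ := Nat.mul_le_mul_left _ (spreadState_le _ _ _)
  have hz' : ∀ j k, spreadState a p (N + 1) 0 k < ρ * spreadState a p (N + 1) 0 j := fun j k =>
    calc spreadState a p (N + 1) 0 k < (N + 1) * (a 0 k + n) := by
          rw [spreadState_zero]
          exact Nat.mul_lt_mul_of_pos_left (by omega) (Nat.succ_pos N)
      _ ≤ (N + 1) * (ρ * a 0 j) := Nat.mul_le_mul_left _ (hbig' j k).le
      _ = ρ * ((N + 1) * a 0 j) := by ring
      _ ≤ _ := Nat.mul_le_mul_left _ (spreadState_le _ _ _)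
  have hzm : StrictMono fun j => ρ * spreadState a p (N + 1) 0 j := fun j k hjk =>
    Nat.mul_lt_mul_of_pos_left (strictMono_spreadState_zero hmono (Nat.succ_pos N) hjk)
      (Nat.pos_of_ne_zero fun h => by have := hbig' j j; rw [h] at this; omega)
  have hle : ∀ i j, spreadState a p (N + 1) (min i N) j ≤ closeState a p N ρ j₀ i j := by
    intro i j
    unfold closeState
    split_ifs
    · exact (spreadState_mono hfix hstep _ (min_le_right _ _) j).trans (hz j).le
    · exact le_rfl
  have hmove : ∀ i < N, closeState a p N ρ j₀ i (p i) = spreadState a p (N + 1) i (p i) := by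
    intro i hi
    have h1 := lt_lastMove p hi
    have h2 := lastMove_le p i (p i)
    unfold closeState
    rw [min_eq_left hi.le, if_neg]
    omega
  have hlate : ∀ i, N ≤ i → ∀ j, closeState a p N ρ j₀ i j =
      if (j₀ : ℕ) ≤ j + (i - N) then ρ * spreadState a p (N + 1) 0 j
      else spreadState a p (N + 1) N j := by
    intro i hi j
    simp only [closeState, min_eq_right hi, and_true]
  have hmv : ∀ i < N, closeMove p N j₀ i = p i := fun i hi => if_pos hi
  have hmv' : ∀ i, N ≤ i → (closeMove p N j₀ i : ℕ) = j₀ - (i - N) - 1 := fun i hi => by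
    rw [closeMove, if_neg (by omega)]
  refine ⟨by omega, ?_, fun j => ?_, fun i hi => ?_, fun i hi j hj => ?_, fun i hi => ?_,
    fun j => ?_, ?_, fun i hi => ?_⟩
  · have := hbig' j₀ j₀
    by_contra h
    have : ρ * a 0 j₀ ≤ 1 * a 0 j₀ := Nat.mul_le_mul_right _ (by omega)
    omega
  · refine lt_of_lt_of_le ?_ (hle 0 j)
    rw [Nat.zero_min]
    have := hz j
    exact Nat.pos_of_ne_zero fun h => by rw [h] at this; omega
  · rcases Nat.lt_or_ge i N with h | h
    · rw [hmv i h, hmove i h]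
      have := hle (i + 1) (p i)
      rw [min_eq_left (by omega)] at this
      exact (spreadState_step hstep _ h).trans_le this
    · have h1 := hmv' i h
      rw [hlate i h, hlate (i + 1) (by omega), if_neg (by omega), if_pos (by omega)]
      exact hz _
  · rcases Nat.lt_or_ge i N with h | h
    · rw [hmv i h] at hj
      unfold closeState
      have e : lastMove p (i + 1) j = lastMove p i j := by simp only [lastMove, if_neg hj]
      rw [min_eq_left h.le, min_eq_left (Nat.succ_le_of_lt h), spreadState_fix hfix _ h hj, e,
        Nat.sub_eq_zero_of_le h.le, Nat.sub_eq_zero_of_le (Nat.succ_le_of_lt h)]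
    · have h1 := hmv' i h
      have h2 : (j : ℕ) ≠ j₀ - (i - N) - 1 := fun e => hj (Fin.ext (e.trans h1.symm))
      rw [hlate i h, hlate (i + 1) (by omega)]
      have : (j₀ : ℕ) ≤ j + (i + 1 - N) ↔ (j₀ : ℕ) ≤ j + (i - N) := by omega
      simp only [this]
  · rcases Nat.lt_or_ge (i + 1) N with h | h
    · rw [hmv _ h, hmv i (by omega), hmove _ h]
      have := hle (i + 1) (p i)
      rw [min_eq_left h.le] at this
      exact (spreadState_legal hlegal _ h).trans this
    · have h1 := hmv' (i + 1) h
      have h2 : (closeMove p N j₀ i : ℕ) = j₀ - (i + 1 - N) := by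
        rcases Nat.lt_or_ge i N with h' | h'
        · have : i = N - 1 := by omega
          rw [hmv i h', this, hlast]
          omega
        · rw [hmv' i h']; omega
      rw [hlate _ h, hlate _ h, if_neg (by omega), if_pos (by omega)]
      refine (hz _).le.trans (hzm.monotone ?_)
      rw [Fin.le_def]
      omega
  · rw [hlate _ (Nat.le_add_right _ _), if_pos (by omega)]
    unfold closeState
    rw [Nat.zero_min, if_neg]
    rintro ⟨h1, h2⟩
    obtain ⟨i, hi, rfl⟩ := hmoved j (by rw [Fin.le_def]; omega)
    have := lt_lastMove p hi
    simp only [lastMove] at h2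
    omega
  · rw [hmv 0 hN]
    rcases Nat.eq_zero_or_pos (j₀ : ℕ) with h | h
    · rw [h, add_zero, hmv _ (by omega), hlast]
      exact Fin.ext (h.trans hfirst.symm)
    · apply Fin.ext
      rw [hmv' _ (by omega), hfirst]
      omega
  · have hb := injective_spreadState hfix hmono (min_le_right i N) (Nat.lt_succ_self N)
    have key : ∀ j k, ρ * spreadState a p (N + 1) 0 j ≠ spreadState a p (N + 1) (min i N) k := by
      intro j k e
      have h0 : lastMove p (min i N) k = 0 := by
        rw [← spreadState_mod (a := a) (Nat.lt_succ_of_le (min_le_right i N)), ← e,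
          spreadState_zero, mul_left_comm, Nat.mul_mod_right]
      rw [eq_of_lastMove_eq_zero hfix (min_le_right i N) h0] at e
      exact (hz' j k).ne' e
    intro j k hjk
    unfold closeState at hjk
    split_ifs at hjk
    · exact hzm.injective hjk
    · exact absurd hjk (key _ _)
    · exact absurd hjk.symm (key _ _)
    · exact hb hjk

end Closing

/-! ### Approximating a finite path by a periodic sequence -/

theorem eq_of_lastMove_eq {n : ℕ} {s : ℕ → RVec n} {p : ℕ → Fin n} {N : ℕ}
    (hfix : ∀ i < N, ∀ j ≠ p i, s (i + 1) j = s i j) {i : ℕ} (hi : i ≤ N) {j : Fin n}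
    (h : lastMove p i j = lastMove p N j) : s i j = s N j := by
  induction N, hi using Nat.le_induction with
  | base => rfl
  | succ N hN ih =>
    have h1 := lastMove_le p i j
    simp only [lastMove] at h
    split_ifs at h with h2
    · omega
    · rw [hfix N (Nat.lt_succ_self N) j h2, ih (fun i hi => hfix i (by omega)) h]

theorem monotone_of_moves {n : ℕ} {s : ℕ → RVec n} {p : ℕ → Fin n} {N : ℕ}
    (hfix : ∀ i < N, ∀ j ≠ p i, s (i + 1) j = s i j)
    (hstep : ∀ i < N, s i (p i) ≤ s (i + 1) (p i)) {i : ℕ} (hi : i ≤ N) (j : Fin n) :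
    s 0 j ≤ s i j := by
  induction i with
  | zero => exact le_rfl
  | succ i ih =>
    refine (ih (by omega)).trans ?_
    by_cases hj : j = p i
    · subst hj; exact hstep i hi
    · exact (hfix i hi j hj).ge

theorem abs_inv_mul_sub_le {W x y e : ℝ} (hW : 0 < W) (h1 : x ≤ W * (y + e))
    (h2 : W * (y - e) ≤ x) : |W⁻¹ * x - y| ≤ e := by
  rw [abs_le]
  constructor
  · have : y - e ≤ W⁻¹ * x := by rwa [le_inv_mul_iff₀ hW]
    linarith
  · have : W⁻¹ * x ≤ y + e := by rwa [inv_mul_le_iff₀ hW]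
    linarith

theorem exists_isPeriodicSeq_close {n : ℕ} {s : ℕ → RVec n} {p : ℕ → Fin n} {N ρ : ℕ}
    {j₀ : Fin n} {δ : ℝ} (hδ : 0 < δ) (hN : 0 < N) (hpos : ∀ j, 0 < s 0 j)
    (hfix : ∀ i < N, ∀ j ≠ p i, s (i + 1) j = s i j)
    (hstep : ∀ i < N, s i (p i) ≤ s (i + 1) (p i))
    (hlegal : ∀ i, i + 1 < N → s (i + 1) (p (i + 1)) ≤ s (i + 1) (p i))
    (hmono : Monotone (s 0)) (hfirst : (p 0 : ℕ) = 0) (hlast : p (N - 1) = j₀)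
    (hmoved : ∀ j, j₀ ≤ j → ∃ i < N, p i = j) (hbig : ∀ j, s N j < ρ * s 0 j)
    (hbig' : ∀ j k, s 0 k < ρ * s 0 j) (hclose : ∀ j, ρ * s 0 j ≤ s N j + δ * stateTime s N)
    (hclose' : ∀ j, j₀ ≤ j → ρ * s 0 j ≤ (1 + δ) * s N j) :
    ∃ s' p' N', IsPeriodicSeq n s' p' N' ρ ∧ (∀ i, Function.Injective (s' i)) ∧
      (∀ i j, ∃ z : ℤ, s' i j = z) ∧ N ≤ N' ∧ ∃ u > 0, ∀ i ≤ N', ∀ j,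
        |u * s' i j - s (min i N) j| ≤ 2 * δ * stateTime s (min i N) := by
  have hspos : ∀ i ≤ N, ∀ j, 0 < s i j := fun i hi j =>
    (hpos j).trans_le (monotone_of_moves hfix hstep hi j)
  have hτ : 0 < stateTime s 0 := sum_pos_of_pos j₀ hpos
  have hτle : ∀ i ≤ N, stateTime s 0 ≤ stateTime s i := fun i hi =>
    Finset.sum_le_sum fun j _ => monotone_of_moves hfix hstep hi j
  have hev : ∀ x : ℝ, 0 < x → ∀ y : ℝ, ∀ᶠ M : ℝ in atTop, y ≤ M * x := fun x hx y =>
    (tendsto_id.atTop_mul_const hx).eventually_ge_atTop y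
  obtain ⟨M, hM0, hM1, hM2, hM3⟩ : ∃ M : ℝ, 0 < M ∧
      (∀ j, n + 1 + ρ ≤ M * (ρ * s 0 j - s N j)) ∧
      (∀ j k, n + 1 + ρ ≤ M * (ρ * s 0 j - s 0 k)) ∧
      ρ * (n + 1) ≤ M * (δ * stateTime s 0) := by
    refine ((eventually_gt_atTop 0).and ((eventually_all.2 fun j => ?_).and
      ((eventually_all.2 fun j => eventually_all.2 fun k => ?_).and ?_))).exists
    · exact hev _ (sub_pos.2 (hbig j)) _
    · exact hev _ (sub_pos.2 (hbig' j k)) _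
    · exact hev _ (mul_pos hδ hτ) _
  have hρ : (1 : ℝ) < ρ := by
    by_contra h
    have := hbig' j₀ j₀
    nlinarith [hpos j₀]
  set a : ℕ → Fin n → ℕ := fun i j => ⌊M * s i j⌋₊ with ha
  have ha1 : ∀ i ≤ N, ∀ j, (a i j : ℝ) ≤ M * s i j := fun i hi j =>
    Nat.floor_le (mul_pos hM0 (hspos i hi j)).le
  have ha2 : ∀ i j, M * s i j < a i j + 1 := fun i j => Nat.lt_floor_add_one _
  have hclosed : IsClosedPath n (closeState a p N ρ j₀) (closeMove p N j₀) (N + j₀) ρ := by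
    refine isClosedPath_close hN (fun i hi j hj => ?_) (fun i hi => ?_) (fun i hi => ?_)
      (fun j k hjk => ?_) hfirst hlast hmoved (fun j => ?_) (fun j k => ?_)
    · simp only [ha, hfix i hi j hj]
    · exact Nat.floor_le_floor (mul_le_mul_of_nonneg_left (hstep i hi) hM0.le)
    · exact Nat.floor_le_floor (mul_le_mul_of_nonneg_left (hlegal i hi) hM0.le)
    · exact Nat.floor_le_floor (mul_le_mul_of_nonneg_left (hmono hjk) hM0.le)
    · have h1 := ha1 N le_rfl j
      have h2 := ha2 0 j
      have h3 := hM1 j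
      have : (a N j : ℝ) + n + 1 ≤ ρ * a 0 j := by nlinarith
      exact_mod_cast this
    · have h1 := ha1 0 (Nat.zero_le _) k
      have h2 := ha2 0 j
      have h3 := hM2 j k
      have : (a 0 k : ℝ) + n < ρ * a 0 j := by nlinarith
      exact_mod_cast this
  refine ⟨_, _, _, hclosed.isPeriodicSeq, hclosed.injective_repeatState,
    fun i j => ⟨((ρ ^ (i / (N + j₀)) * closeState a p N ρ j₀ (i % (N + j₀)) j : ℕ) : ℤ), ?_⟩,
    Nat.le_add_right _ _, (((N : ℝ) + 1) * M)⁻¹, by positivity, fun i hi j => ?_⟩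
  · rw [Int.cast_natCast]; rfl
  have hrep : repeatState (closeState a p N ρ j₀) (N + j₀) ρ i j = closeState a p N ρ j₀ i j := by
    rcases hi.lt_or_eq with h | rfl
    · rw [repeatState, Nat.div_eq_of_lt h, Nat.mod_eq_of_lt h, pow_zero, one_mul]
    · rw [repeatState, Nat.div_self hclosed.length_pos, Nat.mod_self, pow_one, ← hclosed.closed]
  rw [hrep]
  have hi' : min i N ≤ N := min_le_right _ _
  set i' := min i N with hi'_def
  have hK : (0 : ℝ) < (N : ℝ) + 1 := by positivity
  have hE : (n : ℝ) + 1 ≤ ρ * (n + 1) := by nlinarith [(Nat.cast_nonneg n : (0 : ℝ) ≤ n)]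
  have hn0 : (0 : ℝ) ≤ n := Nat.cast_nonneg n
  have hEτ : M * (δ * stateTime s 0) ≤ M * (δ * stateTime s i') :=
    mul_le_mul_of_nonneg_left (mul_le_mul_of_nonneg_left (hτle _ hi') hδ.le) hM0.le
  have hτ' : 0 < M * (δ * stateTime s i') :=
    mul_pos hM0 (mul_pos hδ (hτ.trans_le (hτle _ hi')))
  have hlow : ∀ k ≤ N, ((N : ℝ) + 1) * a k j ≤ (spreadState a p (N + 1) k j : ℕ) := fun k _ => by
    exact_mod_cast spreadState_le (N + 1) k j
  have hupp : ∀ k ≤ N, ((spreadState a p (N + 1) k j : ℕ) : ℝ) ≤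
      ((N : ℝ) + 1) * (a k j + n + 1) := fun k hk => by
    exact_mod_cast (spreadState_lt (Nat.lt_succ_of_le hk) j).le
  refine abs_inv_mul_sub_le (by positivity) ?_ ?_
  · rw [mul_assoc]
    unfold closeState
    rw [← hi'_def]
    split_ifs with h
    · have hs : s i' j = s N j := eq_of_lastMove_eq hfix hi' h.2
      have hz : ρ * s 0 j ≤ s i' j + δ * stateTime s i' := by
        rcases Nat.lt_or_ge i N with hiN | hiN
        · have h1 := hclose' j (by rw [Fin.le_def]; omega)
          have h2 : s i' j ≤ stateTime s i' := le_sum_of_nonneg (fun j => (hspos _ hi' j).le) j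
          nlinarith
        · have : i' = N := min_eq_right hiN
          rw [this]
          exact hclose j
      push_cast
      calc (ρ : ℝ) * (spreadState a p (N + 1) 0 j : ℕ)
          ≤ ρ * (((N : ℝ) + 1) * (a 0 j + n + 1)) :=
            mul_le_mul_of_nonneg_left (hupp 0 (Nat.zero_le _)) (by positivity)
        _ = ((N : ℝ) + 1) * (ρ * (a 0 j + n + 1)) := by ring
        _ ≤ _ := by
            refine mul_le_mul_of_nonneg_left ?_ hK.le
            have h1 := mul_le_mul_of_nonneg_left (ha1 0 (Nat.zero_le _) j)
              (by positivity : (0 : ℝ) ≤ ρ)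
            have h2 := mul_le_mul_of_nonneg_left hz hM0.le
            nlinarith
    · refine (hupp i' hi').trans (mul_le_mul_of_nonneg_left ?_ hK.le)
      have := ha1 i' hi' j
      nlinarith
  · rw [mul_assoc]
    have hgen : ((N : ℝ) + 1) * (M * (s i' j - 2 * δ * stateTime s i')) ≤
        (N + 1) * a i' j := by
      refine mul_le_mul_of_nonneg_left ?_ hK.le
      have := ha2 i' j
      nlinarith
    refine hgen.trans ?_
    unfold closeState
    rw [← hi'_def]
    split_ifs with h
    · have hs : s i' j = s N j := eq_of_lastMove_eq hfix hi' h.2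
      have e : a i' j = a N j := by simp only [ha, hs]
      rw [e]
      have h1 := ha1 N le_rfl j
      have h2 := ha2 0 j
      have h3 := hM1 j
      have h4 : (a N j : ℝ) ≤ ρ * a 0 j := by nlinarith
      push_cast
      calc ((N : ℝ) + 1) * a N j ≤ (N + 1) * (ρ * a 0 j) := mul_le_mul_of_nonneg_left h4 hK.le
        _ = ρ * ((N + 1) * a 0 j) := by ring
        _ ≤ _ := mul_le_mul_of_nonneg_left (hlow 0 (Nat.zero_le _)) (by positivity)
    · exact hlow i' hi'

/-! ### Subdividing a system into linear pieces -/

/-- On `[t 0, t N]`, the map `P` consists of `N` linear pieces of slopes `e_{p i}`, such that the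
slopes of adjacent pieces satisfy the condition of a system. -/
structure IsSubdivision (n : ℕ) (P : ℝ → RVec n) (N : ℕ) (t : ℕ → ℝ) (p : ℕ → Fin n) :
    Prop where
  lt : ∀ i < N, t i < t (i + 1)
  eq : ∀ i < N, ∀ x ∈ Icc (t i) (t (i + 1)), P x = P (t i) + (x - t i) • eVec n (p i)
  legal : ∀ i, i + 1 < N → P (t (i + 1)) (p (i + 1)) ≤ P (t (i + 1)) (p i)

namespace IsNSystem

variable {n : ℕ} {I : Set ℝ} {P : ℝ → RVec n}

theorem nonneg (h : IsNSystem n I P) {q : ℝ} (hq : q ∈ I) (j : Fin n) : 0 ≤ P q j :=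
  (h.2.2.2 q hq).1.1 j

theorem monotone (h : IsNSystem n I P) {q : ℝ} (hq : q ∈ I) : Monotone (P q) :=
  (h.2.2.2 q hq).1.2.1

theorem sum_eq (h : IsNSystem n I P) {q : ℝ} (hq : q ∈ I) : ∑ j, P q j = q :=
  (h.2.2.2 q hq).1.2.2

theorem le_self (h : IsNSystem n I P) {q : ℝ} (hq : q ∈ I) (j : Fin n) : P q j ≤ q :=
  (le_sum_of_nonneg (h.nonneg hq) j).trans_eq (h.sum_eq hq)

theorem slope_legal (h : IsNSystem n I P) {a q b : ℝ} (ha : a < q) (hb : q < b)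
    (hI : Icc a b ⊆ I) {k l : Fin n} (hl : ∀ x ∈ Icc a q, P x = P q + (x - q) • eVec n l)
    (hk : ∀ x ∈ Icc q b, P x = P q + (x - q) • eVec n k) : P q k ≤ P q l := by
  have hq : q ∈ I := hI ⟨ha.le, hb.le⟩
  obtain ⟨ε, hε, k', l', h1, h2, h3⟩ := (h.2.2.2 q hq).2
  have hint : q ∈ interior I := mem_interior_iff_mem_nhds.2
    (mem_of_superset (Icc_mem_nhds ha hb) hI)
  have el : l = l' := by
    set x := max a (q - ε) with hx
    have hxq : x < q := max_lt ha (by linarith)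
    have hxa : a ≤ x := le_max_left _ _
    have := h1 x ⟨hI ⟨hxa, hxq.le.trans hb.le⟩, le_max_right _ _, hxq.le⟩
    rw [hl x ⟨hxa, hxq.le⟩] at this
    exact eVec_ne_zero_inj (sub_ne_zero.2 hxq.ne) this
  have ek : k = k' := by
    set x := min b (q + ε) with hx
    have hxq : q < x := lt_min hb (by linarith)
    have hxb : x ≤ b := min_le_left _ _
    have := h2 x ⟨hI ⟨ha.le.trans hxq.le, hxb⟩, hxq.le, min_le_right _ _⟩
    rw [hk x ⟨hxq.le, hxb⟩] at this
    exact eVec_ne_zero_inj (sub_ne_zero.2 hxq.ne') this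
  subst el ek
  rcases le_or_gt k l with hkl | hkl
  · exact h.monotone hq hkl
  · exact (h3 hint hkl k hkl.le le_rfl).le

theorem exists_subdivision_snoc (h : IsNSystem n I P) {N : ℕ} {t : ℕ → ℝ} {p : ℕ → Fin n}
    (hS : IsSubdivision n P N t p) {c : ℝ} (hc : t N < c) (hI : Icc (t 0) c ⊆ I) {k : Fin n}
    (hk : ∀ x ∈ Icc (t N) c, P x = P (t N) + (x - t N) • eVec n k) :
    ∃ t' p', IsSubdivision n P (N + 1) t' p' ∧ t' 0 = t 0 ∧ t' (N + 1) = c := by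
  refine ⟨fun i => if i ≤ N then t i else c, fun i => if i < N then p i else k,
    ⟨fun i hi => ?_, fun i hi => ?_, fun i hi => ?_⟩, by simp, by simp⟩
  · rcases Nat.lt_or_ge i N with h1 | h1
    · simp only [if_pos h1.le, if_pos (Nat.succ_le_of_lt h1)]
      exact hS.lt i h1
    · have : i = N := by omega
      subst this
      simpa using hc
  · rcases Nat.lt_or_ge i N with h1 | h1
    · simp only [if_pos h1.le, if_pos (Nat.succ_le_of_lt h1), if_pos h1]
      exact hS.eq i h1
    · have : i = N := by omega
      subst this
      simpa using hk
  · rcases Nat.lt_or_ge (i + 1) N with h1 | h1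
    · simp only [if_pos h1.le, if_pos h1, if_pos (show i < N by omega)]
      exact hS.legal i h1
    · have : N = i + 1 := by omega
      subst this
      simp only [le_refl, if_true, lt_irrefl, if_false, Nat.lt_succ_self]
      have hmono : t 0 ≤ t i := by
        have : ∀ k, k ≤ i → t 0 ≤ t k := by
          intro k
          induction k with
          | zero => exact fun _ => le_rfl
          | succ k ih => exact fun hk => (ih (by omega)).trans (hS.lt k (by omega)).le
        exact this i le_rfl
      have hlt := hS.lt i (Nat.lt_succ_self i)
      refine h.slope_legal hlt hc ((Icc_subset_Icc_left hmono).trans hI) (fun x hx => ?_) hk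
      rw [hS.eq i (Nat.lt_succ_self i) x hx,
        hS.eq i (Nat.lt_succ_self i) (t (i + 1)) ⟨hlt.le, le_rfl⟩, add_assoc, ← add_smul]
      congr 2
      ring

theorem exists_subdivision (h : IsNSystem n I P) {a b : ℝ} (hab : a ≤ b) (hI : Icc a b ⊆ I) :
    ∃ N t p, IsSubdivision n P N t p ∧ t 0 = a ∧ t N = b := by
  obtain ⟨-, -, k₀, -⟩ := (h.2.2.2 a (hI ⟨le_rfl, hab⟩)).2
  set S : Set ℝ := {c | c ∈ Icc a b ∧ ∃ N t p, IsSubdivision n P N t p ∧ t 0 = a ∧ t N = c}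
    with hS
  have haS : a ∈ S := ⟨⟨le_rfl, hab⟩, 0, fun _ => a, fun _ => k₀,
    ⟨fun i hi => absurd hi (Nat.not_lt_zero i), fun i hi => absurd hi (Nat.not_lt_zero i),
      fun i hi => absurd hi (Nat.not_lt_zero _)⟩, rfl, rfl⟩
  have hbdd : BddAbove S := ⟨b, fun c hc => hc.1.2⟩
  have hlub := isLUB_csSup ⟨a, haS⟩ hbdd
  set c := sSup S with hc
  have hca : a ≤ c := hlub.1 haS
  have hcb : c ≤ b := hlub.2 fun x hx => hx.1.2
  obtain ⟨ε, hε, k, l, hk, hl, -⟩ := (h.2.2.2 c (hI ⟨hca, hcb⟩)).2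
  have hcS : c ∈ S := by
    obtain ⟨d, hd, hdc, hdc'⟩ := hlub.exists_between (show c - ε < c by linarith)
    rcases hdc'.eq_or_lt with e | hlt
    · exact e ▸ hd
    · obtain ⟨⟨had, hdb⟩, N, t, p, hSd, h0, hN⟩ := hd
      have hd' := hk d ⟨hI ⟨had, hdb⟩, hdc.le, hdc'⟩
      obtain ⟨t', p', h1, h2, h3⟩ := h.exists_subdivision_snoc hSd (c := c) (hN ▸ hlt)
        (h0 ▸ (Icc_subset_Icc_right hcb).trans hI) (k := l) (fun x hx => by
          rw [hN] at hx ⊢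
          rw [hk x ⟨hI ⟨had.trans hx.1, hx.2.trans hcb⟩, hdc.le.trans hx.1, hx.2⟩, hd',
            add_assoc, ← add_smul]
          congr 2
          ring)
      exact ⟨⟨hca, hcb⟩, N + 1, t', p', h1, h2.trans h0, h3⟩
  rcases hcb.eq_or_lt with e | hlt
  · exact e ▸ hcS.2
  · obtain ⟨-, N, t, p, hSd, h0, hN⟩ := hcS
    set d := min b (c + ε) with hd
    have hcd : c < d := lt_min hlt (by linarith)
    have hdb : d ≤ b := min_le_left _ _
    obtain ⟨t', p', h1, h2, h3⟩ := h.exists_subdivision_snoc hSd (c := d) (hN ▸ hcd)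
      (h0 ▸ (Icc_subset_Icc_right hdb).trans hI) (k := k) (fun x hx => by
        rw [hN] at hx ⊢
        exact hl x ⟨hI ⟨hca.trans hx.1, hx.2.trans hdb⟩, hx.1, hx.2.trans (min_le_right _ _)⟩)
    have : d ∈ S := ⟨⟨hca.trans hcd.le, hdb⟩, N + 1, t', p', h1, h2.trans h0, h3⟩
    exact absurd (hlub.1 this) (not_le.2 hcd)

end IsNSystem

namespace IsSubdivision

variable {n : ℕ} {P : ℝ → RVec n} {N : ℕ} {t : ℕ → ℝ} {p : ℕ → Fin n}

theorem truncate (h : IsSubdivision n P N t p) {N' : ℕ} (hN : N' ≤ N) :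
    IsSubdivision n P N' t p :=
  ⟨fun i hi => h.lt i (hi.trans_le hN), fun i hi => h.eq i (hi.trans_le hN),
    fun i hi => h.legal i (hi.trans_le hN)⟩

theorem succ_eq (h : IsSubdivision n P N t p) {i : ℕ} (hi : i < N) :
    P (t (i + 1)) = P (t i) + (t (i + 1) - t i) • eVec n (p i) :=
  h.eq i hi _ ⟨(h.lt i hi).le, le_rfl⟩

theorem fix (h : IsSubdivision n P N t p) {i : ℕ} (hi : i < N) {j : Fin n} (hj : j ≠ p i) :
    P (t (i + 1)) j = P (t i) j := by
  rw [h.succ_eq hi, add_smul_eVec_apply, if_neg hj, add_zero]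

theorem step (h : IsSubdivision n P N t p) {i : ℕ} (hi : i < N) :
    P (t (i + 1)) (p i) = P (t i) (p i) + (t (i + 1) - t i) := by
  rw [h.succ_eq hi, add_smul_eVec_apply, if_pos rfl]

theorem time_mono (h : IsSubdivision n P N t p) {i k : ℕ} (hik : i ≤ k) (hk : k ≤ N) :
    t i ≤ t k := by
  induction k, hik using Nat.le_induction with
  | base => exact le_rfl
  | succ k hik ih => exact (ih (by omega)).trans (h.lt k hk).le

theorem mono (h : IsSubdivision n P N t p) {i k : ℕ} (hik : i ≤ k) (hk : k ≤ N) (j : Fin n) :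
    P (t i) j ≤ P (t k) j := by
  induction k, hik using Nat.le_induction with
  | base => exact le_rfl
  | succ k hik ih =>
    refine (ih (by omega)).trans ?_
    by_cases hj : j = p k
    · subst hj
      rw [h.step hk]
      linarith [h.lt k hk]
    · exact (h.fix hk hj).ge

theorem eq_of_not_moved (h : IsSubdivision n P N t p) {i k : ℕ} (hik : i ≤ k) (hk : k ≤ N)
    {j : Fin n} (hj : ∀ l, i ≤ l → l < k → p l ≠ j) : P (t k) j = P (t i) j := by
  induction k, hik using Nat.le_induction with
  | base => rfl
  | succ k hik ih =>
    rw [h.fix hk (hj k hik (Nat.lt_succ_self k)).symm,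
      ih (by omega) fun l hl hl' => hj l hl (by omega)]

theorem exists_mem (h : IsSubdivision n P N t p) (hN : 0 < N) {x : ℝ} (hx : x ∈ Icc (t 0) (t N)) :
    ∃ i < N, x ∈ Icc (t i) (t (i + 1)) := by
  induction N with
  | zero => exact absurd hN (lt_irrefl 0)
  | succ N ih =>
    rcases le_or_gt (t N) x with h1 | h1
    · exact ⟨N, Nat.lt_succ_self N, h1, hx.2⟩
    · rcases Nat.eq_zero_or_pos N with rfl | h0
      · exact absurd hx.1 (not_le.2 h1)
      · obtain ⟨i, hi, hxi⟩ := ih (h.truncate (Nat.le_succ N)) h0 ⟨hx.1, h1.le⟩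
        exact ⟨i, by omega, hxi⟩

end IsSubdivision

/-! ### Finding an almost closed path in a proper system -/

theorem exists_pos_le_forall {n : ℕ} {f : Fin n → ℝ} (hf : ∀ j, 0 < f j) :
    ∃ e > 0, ∀ j, e ≤ f j := by
  have h : ∀ᶠ e : ℝ in 𝓝[>] 0, 0 < e ∧ ∀ j, e ≤ f j :=
    (eventually_mem_nhdsWithin (a := (0 : ℝ)) (s := Ioi 0)).and
      (eventually_all.2 fun j => (eventually_le_nhds (hf j)).filter_mono nhdsWithin_le_nhds)
  obtain ⟨e, he, he'⟩ := h.exists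
  exact ⟨e, he, he'⟩

namespace IsSubdivision

variable {n : ℕ} {P : ℝ → RVec n} {N : ℕ} {t : ℕ → ℝ} {p : ℕ → Fin n}

theorem exists_move (h : IsSubdivision n P N t p) {j : Fin n} (hj : P (t 0) j < P (t N) j) :
    ∃ i < N, p i = j := by
  by_contra hno
  push Not at hno
  exact hj.ne' (h.eq_of_not_moved (Nat.zero_le N) le_rfl fun l _ hl => hno l hl)

theorem exists_last_move (h : IsSubdivision n P N t p) {i : ℕ} (hi : i < N) :
    ∃ k, i ≤ k ∧ k < N ∧ p k = p i ∧ P (t (k + 1)) (p i) = P (t N) (p i) := by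
  classical
  have hs := Nat.findGreatest_spec (P := fun k => k < N ∧ p k = p i) hi.le ⟨hi, rfl⟩
  have hik := Nat.le_findGreatest (P := fun k => k < N ∧ p k = p i) hi.le ⟨hi, rfl⟩
  refine ⟨_, hik, hs.1, hs.2, ?_⟩
  refine (h.eq_of_not_moved hs.1 le_rfl fun l hl hl' hpl => ?_).symm
  have := Nat.le_findGreatest (P := fun k => k < N ∧ p k = p i) hl'.le ⟨hl', hpl⟩
  omega

/-- There is a last move raising a coordinate to a value at least `κ`; the coordinates which
end at least at `κ` do not move afterwards. -/
theorem exists_last_move_above (h : IsSubdivision n P N t p) {κ : ℝ} {j : Fin n}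
    (h0 : P (t 0) j < κ) (hN : κ ≤ P (t N) j) :
    ∃ i < N, κ ≤ P (t (i + 1)) (p i) ∧
      ∀ k, κ ≤ P (t N) k → P (t (i + 1)) k = P (t N) k := by
  classical
  obtain ⟨i₀, hi₀, rfl⟩ := h.exists_move (h0.trans_le hN)
  obtain ⟨k₀, -, hk₀, hpk₀, hPk₀⟩ := h.exists_last_move hi₀
  have hk₀' : k₀ < N ∧ κ ≤ P (t (k₀ + 1)) (p k₀) := ⟨hk₀, by rw [hpk₀, hPk₀]; exact hN⟩
  have hs := Nat.findGreatest_spec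
    (P := fun k => k < N ∧ κ ≤ P (t (k + 1)) (p k)) hk₀.le hk₀'
  refine ⟨_, hs.1, hs.2, fun j hj => ?_⟩
  refine (h.eq_of_not_moved hs.1 le_rfl fun l hl hl' hpl => ?_).symm
  obtain ⟨k, hk1, hk2, hk3, hk4⟩ := h.exists_last_move hl'
  have := Nat.le_findGreatest (P := fun k => k < N ∧ κ ≤ P (t (k + 1)) (p k)) hk2.le
    ⟨hk2, by rw [hk3, hk4, hpl]; exact hj⟩
  omega

end IsSubdivision

/-- All coordinates of `P q` are positive and `P` has slope `e_1` on the right of `q`. -/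
def IsBasePoint (n : ℕ) (I : Set ℝ) (P : ℝ → RVec n) (q : ℝ) : Prop :=
  q ∈ I ∧ (∀ j, 0 < P q j) ∧ ∃ b ∈ I, q < b ∧ ∀ x ∈ Icc q b, P x = P q + (x - q) • eVec n 0

namespace IsProperSys

variable {n : ℕ} {I : Set ℝ} {P : ℝ → RVec n}

theorem exists_isBasePoint (h : IsProperSys n I P) (hn : 0 < n) (Q : ℝ) :
    ∃ q > Q, IsBasePoint n I P q := by
  obtain ⟨a, haI, ha⟩ := h.2 (max Q 0)
  obtain ⟨b, hbI, hb⟩ := h.2 (max a (P a ⟨0, hn⟩))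
  have hQa : Q < a := (le_max_left _ _).trans_lt ((ha ⟨0, hn⟩).trans_le (h.1.le_self haI _))
  have hab : a < b := (le_max_left _ _).trans_lt ((hb ⟨0, hn⟩).trans_le (h.1.le_self hbI _))
  obtain ⟨N, t, p, hS, rfl, rfl⟩ := h.1.exists_subdivision hab.le (h.1.2.1.out haI hbI)
  obtain ⟨i, hi, hpi⟩ : ∃ i < N, p i = ⟨0, hn⟩ := by
    by_contra hno
    push Not at hno
    have := hS.eq_of_not_moved (Nat.zero_le N) le_rfl (fun l _ hl => hno l hl)
    exact absurd ((le_max_right _ _).trans_lt (hb ⟨0, hn⟩)) (by rw [this]; exact lt_irrefl _)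
  have h0i : t 0 ≤ t i := hS.time_mono (Nat.zero_le i) hi.le
  have hiI : t i ∈ I := h.1.2.1.out haI hbI ⟨h0i, hS.time_mono hi.le le_rfl⟩
  refine ⟨t i, hQa.trans_le h0i, hiI, fun j => ?_, t (i + 1), ?_, hS.lt i hi, fun x hx => ?_⟩
  · exact ((le_max_right _ _).trans_lt (ha j)).trans_le (hS.mono (Nat.zero_le i) hi.le j)
  · exact h.1.2.1.out haI hbI ⟨h0i.trans (hS.lt i hi).le, hS.time_mono (Nat.succ_le_of_lt hi) le_rfl⟩
  · rw [hS.eq i hi x hx, hpi]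

theorem exists_recurrent (h : IsProperSys n I P) (hn : 0 < n) :
    ∃ x : RVec n, (∀ j, 0 ≤ x j) ∧ ∑ j, x j = 1 ∧ ∀ η > 0, ∀ Q : ℝ, ∃ q > Q,
      IsBasePoint n I P q ∧ ∀ j, |P q j - q * x j| ≤ η * q := by
  choose w hw hwb using fun k : ℕ => h.exists_isBasePoint hn (k : ℝ)
  have hw0 : ∀ k, 0 < w k := fun k => (Nat.cast_nonneg k).trans_lt (hw k)
  have hmem : ∀ k, (w k)⁻¹ • P (w k) ∈ Icc (0 : RVec n) 1 := by
    intro k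
    refine ⟨fun j => ?_, fun j => ?_⟩
    · exact mul_nonneg (inv_nonneg.2 (hw0 k).le) (h.1.nonneg (hwb k).1 j)
    · exact (inv_mul_le_iff₀ (hw0 k)).2 (by simpa using h.1.le_self (hwb k).1 j)
  obtain ⟨x, hx, φ, hφ, hlim⟩ := isCompact_Icc.tendsto_subseq hmem
  have hlim' := tendsto_pi_nhds.1 hlim
  refine ⟨x, hx.1, ?_, fun η hη Q => ?_⟩
  · have h1 := tendsto_finsetSum Finset.univ fun j _ => hlim' j
    refine tendsto_nhds_unique h1 (tendsto_const_nhds.congr fun k => ?_)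
    simp only [Function.comp_apply, Pi.smul_apply, smul_eq_mul]
    rw [← Finset.mul_sum, h.1.sum_eq (hwb _).1, inv_mul_cancel₀ (hw0 _).ne']
  · have h1 : ∀ᶠ k in atTop, ∀ j, dist (((fun k => (w k)⁻¹ • P (w k)) ∘ φ) k j) (x j) < η :=
      eventually_all.2 fun j => Metric.tendsto_nhds.1 (hlim' j) η hη
    have h2 : ∀ᶠ k in atTop, Q < w (φ k) := by
      obtain ⟨k₀, hk₀⟩ := exists_nat_gt Q
      filter_upwards [eventually_ge_atTop k₀] with k hk
      have h3 : k₀ ≤ φ k := hk.trans (hφ.id_le k)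
      exact hk₀.trans_le ((Nat.cast_le.2 h3).trans (hw _).le)
    obtain ⟨k, hk1, hk2⟩ := (h1.and h2).exists
    refine ⟨_, hk2, hwb _, fun j => ?_⟩
    have h3 := (hk1 j).le
    have h4 := hw0 (φ k)
    simp only [Function.comp_apply, Pi.smul_apply, smul_eq_mul, Real.dist_eq] at h3
    have e : P (w (φ k)) j - w (φ k) * x j =
        w (φ k) * ((w (φ k))⁻¹ * P (w (φ k)) j - x j) := by
      rw [mul_sub, mul_inv_cancel_left₀ h4.ne']
    rw [e, abs_mul, abs_of_pos h4, mul_comm]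
    exact mul_le_mul_of_nonneg_right h3 h4.le

set_option maxHeartbeats 1000000 in
theorem exists_almost_closed (h : IsProperSys n I P) (hn : 0 < n) {δ : ℝ} (hδ : 0 < δ)
    (Q : ℝ) (F : ℝ → ℝ) :
    ∃ (N : ℕ) (t : ℕ → ℝ) (p : ℕ → Fin n) (ρ : ℕ) (j₀ : Fin n), IsSubdivision n P N t p ∧
      t 0 ∈ I ∧ t N ∈ I ∧ Q ≤ t 0 ∧ F (t 0) ≤ t N ∧ 0 < N ∧ (∀ j, 0 < P (t 0) j) ∧
      (p 0 : ℕ) = 0 ∧ p (N - 1) = j₀ ∧ (∀ j, j₀ ≤ j → ∃ i < N, p i = j) ∧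
      (∀ j, P (t N) j < ρ * P (t 0) j) ∧ (∀ j k, P (t 0) k < ρ * P (t 0) j) ∧
      (∀ j, ρ * P (t 0) j ≤ P (t N) j + δ * t N) ∧
      (∀ j, j₀ ≤ j → ρ * P (t 0) j ≤ (1 + δ) * P (t N) j) := by
  obtain ⟨x, hx0, hx1, hrec⟩ := h.exists_recurrent hn
  have hxle : ∀ j, x j ≤ 1 := fun j => hx1 ▸ le_sum_of_nonneg hx0 j
  obtain ⟨θ, hθ, hθx⟩ : ∃ θ > 0, ∀ j, 0 < x j → 2 * θ ≤ x j := by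
    obtain ⟨e, he, hle⟩ := exists_pos_le_forall (f := fun j => if 0 < x j then x j else 1)
      (fun j => by split_ifs with hj; exacts [hj, one_pos])
    refine ⟨e / 2, by linarith, fun j hj => ?_⟩
    have := hle j
    rw [if_pos hj] at this
    linarith
  obtain ⟨j₁, hj₁⟩ : ∃ j, 0 < x j := by
    by_contra hno
    push Not at hno
    have : ∑ j, x j ≤ 0 := Finset.sum_nonpos fun j _ => hno j
    linarith
  obtain ⟨a, ha, ha1, haδ⟩ : ∃ a : ℝ, 0 < a ∧ a ≤ 1 ∧ 6 * a ≤ δ * θ := by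
    refine ⟨min 1 (δ * θ / 6), lt_min one_pos (by positivity), min_le_left _ _, ?_⟩
    have := min_le_right 1 (δ * θ / 6)
    linarith
  obtain ⟨η, hη, hηa, hηθ⟩ : ∃ η : ℝ, 0 < η ∧ η ≤ a ∧ 2 * η ≤ a * θ := by
    refine ⟨min a (a * θ / 2), lt_min ha (by positivity), min_le_left _ _, ?_⟩
    have := min_le_right a (a * θ / 2)
    linarith
  have hηθ' : η ≤ θ := by nlinarith
  obtain ⟨q₀, hq₀Q, hq₀, hq₀x⟩ := hrec η hη (max Q 0)
  have hq₀pos : 0 < q₀ := (le_max_right _ _).trans_lt hq₀Q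
  obtain ⟨e, he, hePq⟩ := exists_pos_le_forall hq₀.2.1
  obtain ⟨Q₁, hQ₁⟩ : ∃ Q₁ : ℝ, ∀ q ≥ Q₁, q₀ < q ∧ q₀ ≤ q * a ∧ q₀ < q * θ ∧ F q₀ ≤ q * θ ∧
      q₀ * q₀ ≤ q * e := by
    have hev : ∀ y : ℝ, 0 < y → ∀ z : ℝ, ∀ᶠ q : ℝ in atTop, z ≤ q * y := fun y hy z =>
      (tendsto_id.atTop_mul_const hy).eventually_ge_atTop z
    exact eventually_atTop.1 ((eventually_gt_atTop q₀).and ((hev a ha q₀).and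
      (((tendsto_id.atTop_mul_const hθ).eventually_gt_atTop q₀).and
        ((hev θ hθ (F q₀)).and (hev e he (q₀ * q₀))))))
  obtain ⟨η', hη', hη'η, hη'e⟩ : ∃ η' : ℝ, 0 < η' ∧ η' ≤ η ∧ η' * q₀ ≤ e := by
    refine ⟨min η (e / q₀), lt_min hη (by positivity), min_le_left _ _, ?_⟩
    rw [← le_div_iff₀ hq₀pos]
    exact min_le_right _ _
  obtain ⟨q₁, hq₁Q, hq₁, hq₁x⟩ := hrec η' hη' Q₁
  obtain ⟨h01, hqa, hqθ, hqF, hqe⟩ := hQ₁ q₁ hq₁Q.le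
  have hq₁pos : 0 < q₁ := hq₀pos.trans h01
  have hbound : ∀ j, P q₁ j * q₀ ≤ (1 + a) * q₁ * P q₀ j := by
    intro j
    have h1 := (abs_le.1 (hq₁x j)).2
    have h2 := (abs_le.1 (hq₀x j)).1
    have h3 := hePq j
    have h5 : P q₁ j ≤ q₁ * (x j + η') := by linarith
    have h6 : q₁ * q₀ * (x j + η') ≤ q₁ * ((1 + a) * P q₀ j) := by
      rw [mul_assoc]
      refine mul_le_mul_of_nonneg_left ?_ hq₁pos.le
      rcases (hx0 j).eq_or_lt with hj | hj
      · rw [← hj, zero_add, mul_comm]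
        nlinarith
      · have h4 := hθx j hj
        have h7 : q₀ * (x j - η) ≤ P q₀ j := by linarith
        have h8 : x j + η' ≤ (1 + a) * (x j - η) := by nlinarith
        calc q₀ * (x j + η') ≤ q₀ * ((1 + a) * (x j - η)) :=
              mul_le_mul_of_nonneg_left h8 hq₀pos.le
          _ = (1 + a) * (q₀ * (x j - η)) := by ring
          _ ≤ _ := mul_le_mul_of_nonneg_left h7 (by linarith)
    nlinarith
  have hlarge : ∀ j, 0 < x j → θ * q₁ ≤ P q₁ j := by
    intro j hj
    have h1 := (abs_le.1 (hq₁x j)).1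
    have h4 := hθx j hj
    nlinarith
  obtain ⟨L, t, p, hS, ht0, htL⟩ :=
    h.1.exists_subdivision h01.le (h.1.2.1.out hq₀.1 hq₁.1)
  have hmoved : ∀ N ≤ L, ∀ j, θ * q₁ ≤ P (t N) j → ∃ i < N, p i = j := fun N hN j hj =>
    (hS.truncate hN).exists_move (by rw [ht0]; linarith [h.1.le_self hq₀.1 j])
  obtain ⟨i, hiL, hiθ, hilast⟩ := hS.exists_last_move_above (κ := θ * q₁) (j := j₁)
    (by rw [ht0]; linarith [h.1.le_self hq₀.1 j₁]) (htL ▸ hlarge j₁ hj₁)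
  have hNL : i + 1 ≤ L := hiL
  have hI : ∀ k ≤ L, t k ∈ I := fun k hk => h.1.2.1.out hq₀.1 hq₁.1
    ⟨ht0 ▸ hS.time_mono (Nat.zero_le k) hk, htL ▸ hS.time_mono hk le_rfl⟩
  have hNI : t (i + 1) ∈ I := hI _ hNL
  have hNθ : θ * q₁ ≤ t (i + 1) := hiθ.trans (h.1.le_self hNI _)
  have hge : ∀ j, p i ≤ j → θ * q₁ ≤ P (t (i + 1)) j := fun j hj =>
    hiθ.trans (h.1.monotone hNI hj)
  have hNx : ∀ j, (x j - η') * q₁ ≤ P (t (i + 1)) j := by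
    intro j
    rcases (hx0 j).eq_or_lt with hj | hj
    · refine le_trans ?_ (h.1.nonneg hNI j)
      rw [← hj]
      nlinarith
    · have h1 : P (t (i + 1)) j = P q₁ j := htL ▸ hilast j (htL ▸ hlarge j hj)
      rw [h1]
      have := (abs_le.1 (hq₁x j)).1
      linarith
  set ρ : ℕ := ⌊(1 + a) * q₁ / q₀⌋₊ + 1 with hρ
  have hρ1 : (1 + a) * q₁ < ρ * q₀ := by
    rw [← div_lt_iff₀ hq₀pos, hρ]
    push_cast
    exact Nat.lt_floor_add_one _
  have hρ2 : ρ * q₀ ≤ (1 + 2 * a) * q₁ := by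
    have h1 : (⌊(1 + a) * q₁ / q₀⌋₊ : ℝ) ≤ (1 + a) * q₁ / q₀ := Nat.floor_le (by positivity)
    rw [le_div_iff₀ hq₀pos] at h1
    rw [hρ]
    push_cast
    nlinarith
  have hdiff : ∀ j, ρ * P q₀ j ≤ P (t (i + 1)) j + δ * (θ * q₁) := by
    intro j
    have h1 := hNx j
    have h2 : P q₀ j ≤ q₀ * (x j + η) := by linarith [(abs_le.1 (hq₀x j)).2]
    have h3 : (ρ : ℝ) * P q₀ j ≤ ρ * (q₀ * (x j + η)) :=
      mul_le_mul_of_nonneg_left h2 (Nat.cast_nonneg _)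
    have h4 : ρ * q₀ * (x j + η) ≤ (1 + 2 * a) * q₁ * (x j + η) :=
      mul_le_mul_of_nonneg_right hρ2 (by linarith [hx0 j])
    have h5 : (1 + 2 * a) * (x j + η) ≤ x j - η' + δ * θ := by nlinarith [hxle j, hx0 j]
    have h6 := mul_le_mul_of_nonneg_right h5 hq₁pos.le
    nlinarith
  refine ⟨i + 1, t, p, ρ, p i, hS.truncate hNL, ht0 ▸ hq₀.1, hNI, ?_, ?_, Nat.succ_pos i, ?_, ?_,
    rfl, fun j hj => hmoved _ hNL j (hge j hj), fun j => ?_, fun j k => ?_, fun j => ?_,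
    fun j hj => ?_⟩
  · rw [ht0]
    exact (le_max_left _ _).trans hq₀Q.le
  · rw [ht0]
    exact hqF.trans (by linarith)
  · rw [ht0]
    exact hq₀.2.1
  · obtain ⟨b, hbI, hb, hbP⟩ := hq₀.2.2
    have h0L : 0 < L := by omega
    have h01' := hS.lt 0 h0L
    set y := min b (t (0 + 1)) with hy
    have hy0 : q₀ < y := lt_min hb (ht0 ▸ h01')
    have h1 := hbP y ⟨hy0.le, min_le_left _ _⟩
    have h2 := hS.eq 0 h0L y ⟨ht0 ▸ hy0.le, min_le_right _ _⟩
    rw [ht0, h1] at h2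
    have h3 := eVec_ne_zero_inj (k := (⟨0, hn⟩ : Fin n)) (l := p 0) (sub_ne_zero.2 hy0.ne') h2
    rw [← h3]
  · rw [ht0]
    have h1 : P (t (i + 1)) j ≤ P q₁ j := htL ▸ hS.mono hNL le_rfl j
    refine h1.trans_lt ?_
    have h2 := hbound j
    have h3 := mul_lt_mul_of_pos_right hρ1 (hq₀.2.1 j)
    nlinarith
  · rw [ht0]
    have h1 := h.1.le_self hq₀.1 k
    have h2 := hePq j
    have h3 := mul_lt_mul_of_pos_right hρ1 (hq₀.2.1 j)
    have h4 := hq₀.2.1 j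
    have h5 : q₀ * q₀ ≤ q₁ * P q₀ j := hqe.trans (mul_le_mul_of_nonneg_left h2 hq₁pos.le)
    have h6 : 0 < a * q₁ * P q₀ j := by positivity
    have h7 : q₀ * q₀ < ρ * P q₀ j * q₀ := by nlinarith
    exact h1.trans_lt (lt_of_mul_lt_mul_right h7 hq₀pos.le)
  · rw [ht0]
    have := hdiff j
    have := mul_le_mul_of_nonneg_left hNθ hδ.le
    linarith
  · rw [ht0]
    have := hdiff j
    have := mul_le_mul_of_nonneg_left (hge j hj) hδ.le
    linarith

end IsProperSys

/-! ### Density of self-similar systems -/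

theorem IsPeriodicSeq.exists_lt_nval_eq {n m : ℕ} {s : ℕ → RVec n} {p : ℕ → Fin n} {N : ℕ} {ρ : ℝ}
    (h : IsPeriodicSeq n s p N ρ) (T : RVec n → RVec m) (c : ℝ) (i : ℕ) :
    ∃ k < N, nval T (segPt s i c) = nval T (segPt s k c) := by
  induction i using Nat.strong_induction_on with
  | _ i ih =>
    rcases Nat.lt_or_ge i N with hi | hi
    · exact ⟨i, hi, rfl⟩
    · obtain ⟨k, rfl⟩ := Nat.exists_eq_add_of_le' hi
      obtain ⟨l, hl, hkl⟩ := ih k (by have := h.period_pos; omega)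
      refine ⟨l, hl, ?_⟩
      rw [← hkl, ← nval_smul T (segPt s k c) (zero_lt_one.trans h.one_lt)]
      congr 1
      simp only [segPt]
      rw [show k + N + 1 = k + 1 + N by omega, h.state_add, h.state_add]
      module

theorem IsNSystem.nval_eq {n m : ℕ} {I : Set ℝ} {P : ℝ → RVec n} (h : IsNSystem n I P)
    {T : RVec n → RVec m} (hT : IsLinearMap ℝ T) {q : ℝ} (hq : q ∈ I) (j : Fin m) :
    nval T (P q) j = T (P q) j / q := by
  rw [nval, h.sum_eq hq, srt_of_monotone (h.monotone hq), hT.map_smul, Pi.smul_apply, smul_eq_mul,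
    div_eq_inv_mul]

theorem IsSubdivision.segPt_eq {n : ℕ} {P : ℝ → RVec n} {N : ℕ} {t : ℕ → ℝ} {p : ℕ → Fin n}
    (h : IsSubdivision n P N t p) {i : ℕ} (hi : i < N) {c : ℝ} (hc : 0 ≤ c) (hc' : c ≤ 1) :
    segPt (fun i => P (t (min i N))) i c = P ((1 - c) * t i + c * t (i + 1)) := by
  have hlt := h.lt i hi
  simp only [segPt]
  rw [min_eq_left hi.le, min_eq_left (Nat.succ_le_of_lt hi), h.succ_eq hi,
    h.eq i hi ((1 - c) * t i + c * t (i + 1)) ⟨by nlinarith, by nlinarith⟩]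
  module

theorem IsSubdivision.exists_segPt_eq_of_le {n : ℕ} {P : ℝ → RVec n} {N : ℕ} {t : ℕ → ℝ}
    {p : ℕ → Fin n} (h : IsSubdivision n P N t p) (i : ℕ) {c : ℝ} (hc : 0 ≤ c) (hc' : c ≤ 1) :
    ∃ q ∈ Icc (t 0) (t N), segPt (fun i => P (t (min i N))) i c = P q := by
  rcases Nat.lt_or_ge i N with hi | hi
  · refine ⟨_, ⟨?_, ?_⟩, h.segPt_eq hi hc hc'⟩
    · have h1 := h.time_mono (Nat.zero_le i) hi.le
      have h2 := h.lt i hi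
      nlinarith
    · have h1 := h.time_mono (Nat.succ_le_of_lt hi) le_rfl
      have h2 := h.lt i hi
      simp only [Nat.succ_eq_add_one] at h1
      nlinarith
  · refine ⟨t N, ⟨h.time_mono (Nat.zero_le N) le_rfl, le_rfl⟩, ?_⟩
    simp only [segPt]
    rw [min_eq_right hi, min_eq_right (hi.trans (Nat.le_succ i))]
    module

namespace IsProperSys

variable {n m : ℕ} {I : Set ℝ} {P : ℝ → RVec n}

theorem exists_ge (h : IsProperSys n I P) (hn : 0 < n) (Q : ℝ) : ∃ q ∈ I, Q ≤ q := by
  obtain ⟨q, hq, hQ⟩ := h.2 Q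
  exact ⟨q, hq, (hQ ⟨0, hn⟩).le.trans (h.1.le_self hq _)⟩

theorem liminf_spec (h : IsProperSys n I P) (hn : 0 < n) {T : RVec n → RVec m}
    (hT : IsLinearMap ℝ T) {e : ℝ} (he : 0 < e) (j : Fin m) :
    (∃ Q, ∀ q ∈ I, Q ≤ q → muT n m T I P j - e ≤ T (P q) j / q) ∧
      ∀ Q, ∃ q ∈ I, Q ≤ q ∧ T (P q) j / q ≤ muT n m T I P j + e := by
  obtain ⟨B, hB⟩ := exists_bound hT
  have hbd : ∀ q ∈ I, |T (P q) j / q| ≤ B := fun q hq => by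
    rw [← h.1.nval_eq hT hq]
    exact abs_nval_le hB (fun j => h.1.nonneg hq j) j
  have hbasis : (atTop ⊓ 𝓟 I : Filter ℝ).HasBasis (fun _ : ℝ => True) fun Q => Ici Q ∩ I :=
    atTop_basis.inf_principal I
  have : (atTop ⊓ 𝓟 I : Filter ℝ).NeBot := hbasis.neBot_iff.2 fun {Q} _ => by
    obtain ⟨q, hq, hQ⟩ := h.exists_ge hn Q
    exact ⟨q, hQ, hq⟩
  have hev : ∀ᶠ q in (atTop ⊓ 𝓟 I : Filter ℝ), q ∈ I :=
    mem_inf_of_right (mem_principal_self I)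
  have hbdd : IsBoundedUnder (· ≤ ·) (atTop ⊓ 𝓟 I) (fun q => T (P q) j / q) :=
    isBoundedUnder_of_eventually_le (a := B) (hev.mono fun q hq => (abs_le.1 (hbd q hq)).2)
  have hbdd' : IsBoundedUnder (· ≥ ·) (atTop ⊓ 𝓟 I) (fun q => T (P q) j / q) :=
    isBoundedUnder_of_eventually_ge (a := -B) (hev.mono fun q hq => (abs_le.1 (hbd q hq)).1)
  constructor
  · have h1 : muT n m T I P j - e < liminf (fun q => T (P q) j / q) (atTop ⊓ 𝓟 I) := by
      change muT n m T I P j - e < muT n m T I P j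
      linarith
    obtain ⟨Q, -, hQ⟩ := hbasis.eventually_iff.1 (eventually_lt_of_lt_liminf h1 hbdd')
    exact ⟨Q, fun q hq hQq => (hQ ⟨hQq, hq⟩).le⟩
  · have h1 : liminf (fun q => T (P q) j / q) (atTop ⊓ 𝓟 I) < muT n m T I P j + e := by
      change muT n m T I P j < muT n m T I P j + e
      linarith
    intro Q
    obtain ⟨q, ⟨hQ, hq⟩, hlt⟩ := hbasis.frequently_iff.1
      (frequently_lt_of_liminf_lt hbdd.isCoboundedUnder_ge h1) (i := Q) trivial
    exact ⟨q, hq, hQ, hlt.le⟩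

theorem exists_isPeriodicSeq_near (h : IsProperSys n I P) (hn : 0 < n) {T : RVec n → RVec m}
    (hT : IsLinearMap ℝ T) {ε : ℝ} (hε : 0 < ε) :
    ∃ s p N ρ, IsPeriodicSeq n s p N ρ ∧ (∀ i, Function.Injective (s i)) ∧
      (∀ i j, ∃ z : ℤ, s i j = z) ∧ ∀ j, |segInf T s j - muT n m T I P j| ≤ ε := by
  obtain ⟨C, hC0, hC⟩ := exists_lipschitz hT
  obtain ⟨δ, hδ, hδε⟩ : ∃ δ > 0, C * ((n + 1) * (2 * δ)) ≤ ε / 2 := by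
    refine ⟨ε / (4 * (C + 1) * (n + 1)), by positivity, ?_⟩
    have : C * ((n + 1) * (2 * (ε / (4 * (C + 1) * (n + 1))))) = C / (C + 1) * (ε / 2) := by
      field_simp
      ring
    rw [this]
    refine mul_le_of_le_one_left (by positivity) ?_
    rw [div_le_one (by positivity)]
    linarith
  choose Q hQ using fun j => (h.liminf_spec hn hT (half_pos hε) j).1
  choose w hwI hwQ hw using fun j => (h.liminf_spec hn hT (half_pos hε) j).2
  obtain ⟨N, t, p, ρ, j₀, hS, ht0, htN, hQt, hF, hN, hpos, hfirst, hlast, hmoved, hbig, hbig',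
    hclose, hclose'⟩ := h.exists_almost_closed hn hδ (∑ j, |Q j|) (fun q => ∑ j, |w j q|)
  have htI : ∀ q ∈ Icc (t 0) (t N), q ∈ I := fun q hq => h.1.2.1.out ht0 htN hq
  have hiI : ∀ i, t (min i N) ∈ I := fun i => htI _
    ⟨hS.time_mono (Nat.zero_le _) (min_le_right _ _), hS.time_mono (min_le_right _ _) le_rfl⟩
  have htime : ∀ i, stateTime (fun i => P (t (min i N))) i = t (min i N) :=
    fun i => h.1.sum_eq (hiI i)
  have ht0pos : 0 < t 0 := (hpos ⟨0, hn⟩).trans_le (h.1.le_self ht0 _)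
  have htpos : ∀ i, 0 < t (min i N) := fun i =>
    ht0pos.trans_le (hS.time_mono (Nat.zero_le _) (min_le_right _ _))
  obtain ⟨s', p', N', hper, hinj, hint, hNN', u, hu, hclose''⟩ :=
    exists_isPeriodicSeq_close (s := fun i => P (t i)) (p := p) (N := N) (ρ := ρ) (j₀ := j₀) hδ hN
      hpos (fun i hi j hj => hS.fix hi hj) (fun i hi => hS.mono (Nat.le_succ i) hi _) hS.legal
      (h.1.monotone ht0) hfirst hlast hmoved hbig hbig'
      (fun j => by rw [stateTime, h.1.sum_eq htN]; exact hclose j) hclose'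
  have hnear : ∀ i < N', ∀ c, 0 ≤ c → c ≤ 1 → ∀ j,
      |nval T (segPt s' i c) j - nval T (segPt (fun i => P (t (min i N))) i c) j| ≤ ε / 2 := by
    intro i hi c hc hc' j
    refine (abs_nval_segPt_sub_le hC (fun j => ⟨h.1.nonneg (hiI i) j, h.1.nonneg (hiI _) j⟩)
      ⟨(htime i).symm ▸ htpos i, (htime (i + 1)).symm ▸ htpos (i + 1)⟩ hper.isMoveSeq.pos hu
      (by positivity : 0 ≤ 2 * δ) ?_ ?_ hc hc' j).trans hδε
    · exact hclose'' i hi.le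
    · exact hclose'' (i + 1) hi
  refine ⟨s', p', N', ρ, hper, hinj, hint, fun j => ?_⟩
  have g := isGLB_segInf hT hper.isMoveSeq.pos j
  rw [abs_sub_le_iff]
  constructor
  · have hwmem : w j (t 0) ∈ Icc (t 0) (t N) := by
      refine ⟨hwQ j _, le_trans ?_ hF⟩
      exact (le_abs_self _).trans
        (Finset.single_le_sum (f := fun j => |w j (t 0)|) (fun _ _ => abs_nonneg _)
          (Finset.mem_univ j))
    obtain ⟨i, hi, hwi1, hwi2⟩ := hS.exists_mem hN hwmem
    have hlt := hS.lt i hi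
    have hne : t (i + 1) - t i ≠ 0 := by linarith
    set c := (w j (t 0) - t i) / (t (i + 1) - t i) with hcdef
    have hc : 0 ≤ c := div_nonneg (by linarith) (by linarith)
    have hc' : c ≤ 1 := by rw [hcdef, div_le_one (by linarith)]; linarith
    have hx : (1 - c) * t i + c * t (i + 1) = w j (t 0) := by
      have : c * (t (i + 1) - t i) = w j (t 0) - t i := div_mul_cancel₀ _ hne
      linarith
    have h1 := (abs_le.1 (hnear i (hi.trans_le hNN') c hc hc' j)).2
    rw [hS.segPt_eq hi hc hc', hx, h.1.nval_eq hT (hwI j _)] at h1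
    have h2 := g.1 ⟨i, c, hc, hc', rfl⟩
    have h3 := hw j (t 0)
    linarith
  · have : muT n m T I P j - ε ≤ segInf T s' j := by
      refine g.2 ?_
      rintro _ ⟨i, c, hc, hc', rfl⟩
      obtain ⟨k, hk, hik⟩ := hper.exists_lt_nval_eq T c i
      rw [hik]
      obtain ⟨q, hq, hkq⟩ := hS.exists_segPt_eq_of_le k hc hc'
      have h1 := (abs_le.1 (hnear k hk c hc hc' j)).1
      rw [hkq, h.1.nval_eq hT (htI q hq)] at h1
      have h2 := hQ j q (htI q hq) (le_trans ((le_abs_self _).trans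
        (Finset.single_le_sum (f := fun j => |Q j|) (fun _ _ => abs_nonneg _)
          (Finset.mem_univ j))) (hQt.trans hq.1))
      linarith
    linarith

end IsProperSys

theorem IsSelfSimilar.isProperSys {n : ℕ} {δ : ℝ} {I : Set ℝ} {P : ℝ → RVec n}
    (h : IsSelfSimilar n I P) (hr : IsRigid n δ I P) : IsProperSys n I P := by
  obtain ⟨⟨hP, hcl, hI0, hsw⟩, -⟩ := hr
  obtain ⟨-, ρ, hρ, hself⟩ := h
  refine ⟨hP, fun M => ?_⟩
  have hne : I.Nonempty := hP.2.2.1.mono interior_subset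
  have hbdd : BddBelow I := ⟨0, fun x hx => (hI0 hx).le⟩
  have haI : sInf I ∈ I := hcl.csInf_mem hne hbdd
  have hfr : sInf I ∈ frontier I := by
    rw [hcl.frontier_eq]
    refine ⟨haI, fun hint => ?_⟩
    obtain ⟨e, he, hball⟩ := Metric.mem_nhds_iff.1 (mem_interior_iff_mem_nhds.1 hint)
    have hmem : sInf I - e / 2 ∈ I := hball (by
      rw [Metric.mem_ball, Real.dist_eq, abs_lt]
      constructor <;> linarith)
    have := csInf_le hbdd hmem
    linarith
  obtain ⟨hpos, -⟩ := hsw _ ⟨haI, Or.inl hfr⟩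
  have hk : ∀ k : ℕ, ρ ^ k * sInf I ∈ I ∧ P (ρ ^ k * sInf I) = ρ ^ k • P (sInf I) := by
    intro k
    induction k with
    | zero => simpa using haI
    | succ k ih =>
      rw [pow_succ', mul_assoc]
      refine ⟨(hself _ ih.1).1, ?_⟩
      rw [(hself _ ih.1).2, ih.2, smul_smul]
  have htend : ∀ᶠ k : ℕ in atTop, ∀ j, M < ρ ^ k * P (sInf I) j :=
    eventually_all.2 fun j =>
      ((tendsto_pow_atTop_atTop_of_one_lt hρ).atTop_mul_const (hpos j)).eventually_gt_atTop M
  obtain ⟨k, hkM⟩ := htend.exists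
  refine ⟨_, (hk k).1, fun j => ?_⟩
  rw [(hk k).2]
  exact hkM j

theorem IsProperSys.mem_closure_segInf {n m : ℕ} {I : Set ℝ} {P : ℝ → RVec n}
    (h : IsProperSys n I P) (hn : 0 < n) {T : RVec n → RVec m} (hT : IsLinearMap ℝ T) :
    muT n m T I P ∈ closure {y | ∃ s p N ρ, IsPeriodicSeq n s p N ρ ∧
      (∀ i, Function.Injective (s i)) ∧ (∀ i j, ∃ z : ℤ, s i j = z) ∧ segInf T s = y} := by
  refine Metric.mem_closure_iff.2 fun ε hε => ?_
  obtain ⟨s, p, N, ρ, h1, h2, h3, h4⟩ := h.exists_isPeriodicSeq_near hn hT (half_pos hε)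
  refine ⟨_, ⟨s, p, N, ρ, h1, h2, h3, rfl⟩, lt_of_le_of_lt ?_ (half_lt_self hε)⟩
  refine (dist_pi_le_iff (half_pos hε).le).2 fun j => ?_
  rw [dist_comm, Real.dist_eq]
  exact h4 j

/-- **Corollary (density of self-similar points and connectedness of the spectrum).**
For a linear map `T : ℝ^n → ℝ^m`, the set `S₁` of points `μ_T(S)` over self-similar
integral `n`-systems `S` is a dense subset of the spectrum
`S* = {μ_T(P) : P a proper n-system}`, and `S*` is a connected subset of `ℝ^m`. -/
theorem self_similar_dense_and_connected (n m : ℕ) (hn : 2 ≤ n)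
    (T : RVec n → RVec m) (hT : IsLinearMap ℝ T) :
    ({y : RVec m | ∃ I S, IsRigid n 1 I S ∧ IsSelfSimilar n I S ∧ muT n m T I S = y}
        ⊆ {y : RVec m | ∃ I P, IsProperSys n I P ∧ muT n m T I P = y}) ∧
    ({y : RVec m | ∃ I P, IsProperSys n I P ∧ muT n m T I P = y}
        ⊆ closure {y : RVec m |
            ∃ I S, IsRigid n 1 I S ∧ IsSelfSimilar n I S ∧ muT n m T I S = y}) ∧
    IsConnected {y : RVec m | ∃ I P, IsProperSys n I P ∧ muT n m T I P = y} := by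
  have hn0 : 0 < n := by omega
  refine ⟨?_, ?_, ?_⟩
  · rintro y ⟨I, S, hr, hs, rfl⟩
    exact ⟨I, S, hs.isProperSys hr, rfl⟩
  · rintro y ⟨I, P, hP, rfl⟩
    refine closure_mono ?_ (hP.mem_closure_segInf hn0 hT)
    rintro y ⟨s, p, N, ρ, h, hinj, hint, rfl⟩
    exact ⟨_, _, h.isMoveSeq.isRigid hinj hint,
      h.isMoveSeq.isSelfSimilar h.one_lt h.state_add h.move_add,
      h.isMoveSeq.muT_eq_segInf h.one_lt h.state_add h.move_add hT⟩
  · obtain ⟨D, hD, hDne, hmem, hsub⟩ := exists_preconnected_core hn0 hT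
    refine ⟨hDne.mono hsub, hD.subset_closure hsub ?_⟩
    rintro y ⟨I, P, hP, rfl⟩
    refine closure_mono ?_ (hP.mem_closure_segInf hn0 hT)
    rintro y ⟨s, p, N, ρ, h, -, -, rfl⟩
    exact hmem s p N ρ h
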